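/- arXiv:0912.5003 — 2 statements merged into one kernel-verified Lean document; each statement's English description precedes it below -/
import Mathlib

section
/- Let Λ be an artin algebra and M an indecomposable finite length Λ-module which is a brick. Let Y be a module with a homogeneous M-filtration M = M[1] ⊂ M[2] ⊂ ⋯ ⊂ M[m] = Y, and assume this is the only M-filtration of Y. If U is a piling submodule of Y with |U| ≥ |M|, then U = M[j] for some 1 ≤ j ≤ m. -/
/-!
Setting: `k` is a commutative artinian ring and `Λ` an artin `k`-algebra
(an algebra over `k` which is finitely generated as a `k`-module).
All modules considered are `Λ`-modules of finite length (`IsFiniteLength Λ M`),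
and `|M|` denotes the length of `M`, implemented as the height
`Order.height (⊤ : Submodule Λ M)` of the lattice of submodules
(for a submodule `N` of an ambient module, its length is `Order.height N`).
-/

universe u v

open Submodule

section GRDefs

variable (Λ : Type u) [Ring Λ]

/-- A submodule `N` of an ambient module is indecomposable (as a module):
it is nonzero, and whenever it is the direct sum of two submodules, one of them is zero. -/
def IndecSub {Y : Type v} [AddCommGroup Y] [Module Λ Y] (N : Submodule Λ Y) : Prop :=
  N ≠ ⊥ ∧ ∀ A B : Submodule Λ Y, A ≤ N → B ≤ N → A ⊔ B = N → A ⊓ B = ⊥ → A = ⊥ ∨ B = ⊥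

/-- A module is indecomposable iff its top submodule is. -/
def IndecMod (M : Type v) [AddCommGroup M] [Module Λ M] : Prop :=
  IndecSub Λ (⊤ : Submodule Λ M)

/-- The length `|M|` of a module, as an extended natural number. -/
noncomputable def modLen (M : Type v) [AddCommGroup M] [Module Λ M] : ℕ∞ :=
  Order.height (⊤ : Submodule Λ M)

/-- The length `|N|` of a submodule of an ambient module, as a natural number. -/
noncomputable def subLen {Y : Type v} [AddCommGroup Y] [Module Λ Y] (N : Submodule Λ Y) : ℕ :=
  (Order.height N).toNat

open Classical in
/-- Fuel-based auxiliary function for the Gabriel-Roiter measure. -/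
noncomputable def muAux {Y : Type v} [AddCommGroup Y] [Module Λ Y] :
    ℕ → Submodule Λ Y → ℝ
  | 0, _ => 0
  | n + 1, N =>
      (if IndecSub Λ N then (2 : ℝ) ^ (-(subLen Λ N : ℤ)) else 0)
        + sSup (muAux n '' {N' : Submodule Λ Y | N' < N})

/-- The Gabriel-Roiter measure `μ(N)` of a submodule `N` of an ambient module:
`μ(0) = 0`; if `N ≠ 0` is decomposable, `μ(N)` is the maximum of `μ(N')` over proper
submodules `N'` of `N`; if `N` is indecomposable, `μ(N) = 2^(-|N|)` plus this maximum.
(For modules of finite length the supremum is a maximum and the fuel `|N|` suffices for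
the recursion, so this agrees with the usual inductive definition; the measure of a
submodule depends only on the sublattice of its submodules, hence it does not matter
in which ambient module it is computed.) -/
noncomputable def mu {Y : Type v} [AddCommGroup Y] [Module Λ Y] (N : Submodule Λ Y) : ℝ :=
  muAux Λ (subLen Λ N) N

/-- The Gabriel-Roiter measure of a module. -/
noncomputable def muMod (M : Type v) [AddCommGroup M] [Module Λ M] : ℝ :=
  mu Λ (⊤ : Submodule Λ M)

/-- `X` is a Gabriel-Roiter submodule of the (indecomposable, non-simple) ambient
module `Y`: `X` is an indecomposable proper submodule with `μ(Y) = μ(X) + 2^(-|Y|)`. -/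
def IsGRSub {Y : Type v} [AddCommGroup Y] [Module Λ Y] (X : Submodule Λ Y) : Prop :=
  IndecMod Λ Y ∧ IndecSub Λ X ∧ X ≠ ⊤ ∧
    mu Λ (⊤ : Submodule Λ Y) = mu Λ X + (2 : ℝ) ^ (-(subLen Λ (⊤ : Submodule Λ Y) : ℤ))

/-- A map `u : X → Y` is a Gabriel-Roiter inclusion iff it is injective and its
image is a Gabriel-Roiter submodule of `Y`. -/
def IsGRInclusion {X Y : Type v} [AddCommGroup X] [Module Λ X] [AddCommGroup Y] [Module Λ Y]
    (u : X →ₗ[Λ] Y) : Prop :=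
  Function.Injective u ∧ IsGRSub Λ (LinearMap.range u)

/-- A linear map is a split monomorphism. -/
def IsSplitMonoHom {A B : Type v} [AddCommGroup A] [Module Λ A] [AddCommGroup B] [Module Λ B]
    (f : A →ₗ[Λ] B) : Prop :=
  ∃ g : B →ₗ[Λ] A, g.comp f = LinearMap.id

/-- A linear map is a split epimorphism. -/
def IsSplitEpiHom {A B : Type v} [AddCommGroup A] [Module Λ A] [AddCommGroup B] [Module Λ B]
    (f : A →ₗ[Λ] B) : Prop :=
  ∃ g : B →ₗ[Λ] A, f.comp g = LinearMap.id

/-- A morphism `f` in the category of finite length `Λ`-modules is irreducible if it is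
neither a split monomorphism nor a split epimorphism and, whenever `f = g ∘ h` with the
intermediate module of finite length, either `h` is a split monomorphism or `g` is a
split epimorphism. -/
def IsIrreducibleHom {A B : Type v} [AddCommGroup A] [Module Λ A] [AddCommGroup B] [Module Λ B]
    (f : A →ₗ[Λ] B) : Prop :=
  ¬ IsSplitMonoHom Λ f ∧ ¬ IsSplitEpiHom Λ f ∧
    ∀ (Z : Type v) [AddCommGroup Z] [Module Λ Z], IsFiniteLength Λ Z →
      ∀ (h : A →ₗ[Λ] Z) (g : Z →ₗ[Λ] B), f = g.comp h →
        IsSplitMonoHom Λ h ∨ IsSplitEpiHom Λ g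

/-- An indecomposable submodule `U` of the ambient module is piling provided
`μ(V) ≤ μ(U)` for every indecomposable submodule `V` with `|V| ≤ |U|`. -/
def IsPilingSub {Y : Type v} [AddCommGroup Y] [Module Λ Y] (U : Submodule Λ Y) : Prop :=
  IndecSub Λ U ∧ ∀ V : Submodule Λ Y, IndecSub Λ V →
    Order.height V ≤ Order.height U → mu Λ V ≤ mu Λ U

/-- A Gabriel-Roiter filtration `c 0 ⊂ c 1 ⊂ ⋯ ⊂ c t = N` of an (indecomposable)
submodule `N`: a chain of indecomposable submodules starting at a simple module such
that each inclusion `c i ⊂ c (i+1)` is a Gabriel-Roiter inclusion,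
i.e. `μ(c (i+1)) = μ(c i) + 2^(-|c (i+1)|)`. -/
def IsGRFiltration {Y : Type v} [AddCommGroup Y] [Module Λ Y] {t : ℕ}
    (c : Fin (t + 1) → Submodule Λ Y) (N : Submodule Λ Y) : Prop :=
  c (Fin.last t) = N ∧
  IsSimpleModule Λ (c 0) ∧
  (∀ i : Fin (t + 1), IndecSub Λ (c i)) ∧
  ∀ i : Fin t, c i.castSucc < c i.succ ∧
    mu Λ (c i.succ) = mu Λ (c i.castSucc) + (2 : ℝ) ^ (-(subLen Λ (c i.succ) : ℤ))

/-- A brick: a nonzero module all of whose nonzero endomorphisms are invertible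
(i.e. the endomorphism ring is a division ring). -/
def IsBrick (M : Type v) [AddCommGroup M] [Module Λ M] : Prop :=
  (∃ x : M, x ≠ 0) ∧ ∀ f : M →ₗ[Λ] M, f ≠ 0 → Function.Bijective f

/-- An `M`-filtration `0 = c 0 ⊂ c 1 ⊂ ⋯ ⊂ c m = Y` of the module `Y`
(so `c j` is the module `M[j]`, with `M[0] = 0`, and the `M`-length of `Y` is `m`):
all consecutive factors `c (i+1) / c i` are isomorphic to `M`. -/
structure IsMFiltration (M : Type v) [AddCommGroup M] [Module Λ M]
    {Y : Type v} [AddCommGroup Y] [Module Λ Y] {m : ℕ}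
    (c : Fin (m + 1) → Submodule Λ Y) : Prop where
  bot : c 0 = ⊥
  top : c (Fin.last m) = ⊤
  lt : ∀ i : Fin m, c i.castSucc < c i.succ
  quot : ∀ i : Fin m,
    Nonempty ((↥(c i.succ) ⧸ comap (c i.succ).subtype (c i.castSucc)) ≃ₗ[Λ] M)

/-- A homogeneous `M`-filtration: an `M`-filtration in which moreover all the
`M[i] = c i` with `i ≥ 1` are indecomposable and all the inclusions
`M[i-1] ⊂ M[i]` for `2 ≤ i ≤ m` are irreducible monomorphisms. -/
structure IsHomogMFiltration (M : Type v) [AddCommGroup M] [Module Λ M]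
    {Y : Type v} [AddCommGroup Y] [Module Λ Y] {m : ℕ}
    (c : Fin (m + 1) → Submodule Λ Y) extends IsMFiltration Λ M c : Prop where
  indec : ∀ i : Fin (m + 1), i ≠ 0 → IndecSub Λ (c i)
  irr : ∀ i : Fin m, (i : ℕ) ≠ 0 →
    IsIrreducibleHom Λ (Submodule.inclusion (toIsMFiltration.lt i).le)

end GRDefs

/-- `x` is an integer multiple of `2 ^ (-n)`. -/
def IsDyadic (n : ℕ) (x : ℝ) : Prop := ∃ a : ℤ, x = a * (2 : ℝ) ^ (-(n : ℤ))

namespace IsDyadic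

lemma zero (n : ℕ) : IsDyadic n 0 := ⟨0, by simp⟩

lemma unit (n : ℕ) : IsDyadic n ((2 : ℝ) ^ (-(n : ℤ))) := ⟨1, by simp⟩

lemma mono {n n' : ℕ} (h : n ≤ n') {x : ℝ} (hx : IsDyadic n x) : IsDyadic n' x := by
  obtain ⟨a, rfl⟩ := hx
  obtain ⟨d, rfl⟩ := Nat.exists_eq_add_of_le h
  refine ⟨a * 2 ^ d, ?_⟩
  push_cast
  rw [neg_add, zpow_add₀ two_ne_zero, zpow_neg _ (d : ℤ), zpow_natCast]
  field_simp

lemma add {n : ℕ} {x y : ℝ} (hx : IsDyadic n x) (hy : IsDyadic n y) : IsDyadic n (x + y) := by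
  obtain ⟨a, rfl⟩ := hx
  obtain ⟨b, rfl⟩ := hy
  exact ⟨a + b, by push_cast; ring⟩

/-- Two distinct multiples of `2 ^ (-n)` differ by at least `2 ^ (-n)`. -/
lemma add_le_of_lt {n : ℕ} {x y : ℝ} (hx : IsDyadic n x) (hy : IsDyadic n y) (h : x < y) :
    x + (2 : ℝ) ^ (-(n : ℤ)) ≤ y := by
  obtain ⟨a, rfl⟩ := hx
  obtain ⟨b, rfl⟩ := hy
  have hp : (0 : ℝ) < (2 : ℝ) ^ (-(n : ℤ)) := by positivity
  have hab : a < b := by exact_mod_cast lt_of_mul_lt_mul_right h hp.le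
  have hab' : (a : ℝ) + 1 ≤ b := by exact_mod_cast hab
  nlinarith

lemma isGreatest_sSup {n : ℕ} {S : Set ℝ} (hS : ∀ x ∈ S, IsDyadic n x) (hne : S.Nonempty)
    (hb : BddAbove S) : IsGreatest S (sSup S) := by
  have hp : (0 : ℝ) < (2 : ℝ) ^ (-(n : ℤ)) := by positivity
  obtain ⟨x, hx, hlt⟩ := exists_lt_of_lt_csSup hne (sub_lt_self (sSup S) hp)
  have hg : IsGreatest S x := by
    refine ⟨hx, fun y hy ↦ ?_⟩
    by_contra! hxy
    have := (hS x hx).add_le_of_lt (hS y hy) hxy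
    have := le_csSup hb hy
    linarith
  rwa [hg.csSup_eq]

end IsDyadic

lemma two_zpow_neg_le {n n' : ℕ} (h : n ≤ n') :
    (2 : ℝ) ^ (-(n' : ℤ)) ≤ (2 : ℝ) ^ (-(n : ℤ)) :=
  zpow_le_zpow_right₀ one_le_two (by omega)

lemma two_zpow_neg_succ (n : ℕ) :
    (2 : ℝ) ^ (-((n + 1 : ℕ) : ℤ)) = (2 : ℝ) ^ (-(n : ℤ)) / 2 := by
  push_cast
  rw [neg_add, zpow_add₀ two_ne_zero, zpow_neg_one, div_eq_mul_inv]

section GabrielRoiter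

variable {Λ : Type u} [Ring Λ] {Y : Type v} [AddCommGroup Y] [Module Λ Y]

lemma IndecSub.ne_bot {N : Submodule Λ Y} (h : IndecSub Λ N) : N ≠ ⊥ := h.1

lemma not_indecSub_bot : ¬ IndecSub Λ (⊥ : Submodule Λ Y) := fun h ↦ h.1 rfl

lemma exists_decomp {N : Submodule Λ Y} (h0 : N ≠ ⊥) (h : ¬ IndecSub Λ N) :
    ∃ A B : Submodule Λ Y, A < N ∧ B < N ∧ A ⊔ B = N ∧ A ⊓ B = ⊥ ∧ A ≠ ⊥ ∧ B ≠ ⊥ := by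
  simp only [IndecSub, not_and, not_forall, not_or] at h
  obtain ⟨A, B, hA, hB, hs, hi, hA0, hB0⟩ := h h0
  refine ⟨A, B, lt_of_le_of_ne hA ?_, lt_of_le_of_ne hB ?_, hs, hi, hA0, hB0⟩
  · rintro rfl
    exact hB0 (by rwa [inf_eq_right.2 hB] at hi)
  · rintro rfl
    exact hA0 (by rwa [inf_eq_left.2 hA] at hi)

lemma indecSub_iff_isCompl {N : Submodule Λ Y} :
    IndecSub Λ N ↔ N ≠ ⊥ ∧ ∀ A B : Submodule Λ N, IsCompl A B → A = ⊥ ∨ B = ⊥ := by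
  refine and_congr_right fun h0 ↦ ⟨fun h A B hAB ↦ ?_, fun h A B hA hB hs hi ↦ ?_⟩
  · have := h (A.map N.subtype) (B.map N.subtype) (Submodule.map_subtype_le _ _)
      (Submodule.map_subtype_le _ _)
      (by rw [← Submodule.map_sup, hAB.sup_eq_top, Submodule.map_subtype_top])
      (by rw [← Submodule.map_inf _ N.injective_subtype, hAB.inf_eq_bot, Submodule.map_bot])
    have hinj := Submodule.map_injective_of_injective N.injective_subtype
    exact this.imp (fun h ↦ hinj (by rw [h, Submodule.map_bot]))
      (fun h ↦ hinj (by rw [h, Submodule.map_bot]))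
  · have hA' : (A.comap N.subtype).map N.subtype = A := by
      rw [Submodule.map_comap_subtype, inf_eq_right.2 hA]
    have hB' : (B.comap N.subtype).map N.subtype = B := by
      rw [Submodule.map_comap_subtype, inf_eq_right.2 hB]
    have hinj := Submodule.map_injective_of_injective N.injective_subtype
    have hc : IsCompl (A.comap N.subtype) (B.comap N.subtype) := by
      refine ⟨disjoint_iff.2 (hinj ?_), codisjoint_iff.2 (hinj ?_)⟩
      · rw [Submodule.map_inf _ N.injective_subtype, hA', hB', hi, Submodule.map_bot]
      · rw [Submodule.map_sup, hA', hB', hs, Submodule.map_subtype_top]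
    rcases h _ _ hc with h | h
    · left; rw [← hA', h, Submodule.map_bot]
    · right; rw [← hB', h, Submodule.map_bot]

lemma IndecSub.of_equiv {N N' : Submodule Λ Y} (e : N ≃ₗ[Λ] N') (h : IndecSub Λ N) :
    IndecSub Λ N' := by
  rw [indecSub_iff_isCompl] at h ⊢
  refine ⟨?_, fun A B hAB ↦ ?_⟩
  · rintro rfl
    refine h.1 (N.subsingleton_iff_eq_bot.1 e.toEquiv.subsingleton)
  · have := h.2 _ _ ((Submodule.orderIsoMapComap e.symm).isCompl hAB)
    simpa using this

lemma indecSub_range_iff {N : Submodule Λ Y} {f : N →ₗ[Λ] Y} (hf : Function.Injective f) :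
    IndecSub Λ (LinearMap.range f) ↔ IndecSub Λ N :=
  ⟨.of_equiv (LinearEquiv.ofInjective f hf).symm, .of_equiv (LinearEquiv.ofInjective f hf)⟩

/-- Every submodule of the range of `f : N → Y` is the range of a restriction of `f`. -/
lemma exists_range_comp_inclusion {N : Submodule Λ Y} (f : N →ₗ[Λ] Y) {V : Submodule Λ Y}
    (hV : V ≤ LinearMap.range f) :
    ∃ (N' : Submodule Λ Y) (h : N' ≤ N), LinearMap.range (f ∘ₗ Submodule.inclusion h) = V := by
  refine ⟨(V.comap f).map N.subtype, Submodule.map_subtype_le _ _, ?_⟩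
  rw [LinearMap.range_comp, Submodule.range_inclusion,
    Submodule.comap_map_eq_of_injective N.injective_subtype, Submodule.map_comap_eq,
    inf_eq_right.2 hV]

lemma range_comp_inclusion_le {N N' : Submodule Λ Y} (f : N →ₗ[Λ] Y) (h : N' ≤ N) :
    LinearMap.range (f ∘ₗ Submodule.inclusion h) ≤ LinearMap.range f :=
  LinearMap.range_comp_le_range _ _

lemma injective_comp_inclusion {N N' : Submodule Λ Y} {f : N →ₗ[Λ] Y}
    (hf : Function.Injective f) (h : N' ≤ N) :
    Function.Injective (f ∘ₗ Submodule.inclusion h) :=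
  hf.comp (Submodule.inclusion_injective h)

lemma muAux_nonneg (n : ℕ) (N : Submodule Λ Y) : 0 ≤ muAux Λ n N := by
  induction n generalizing N with
  | zero => simp [muAux]
  | succ n ih =>
    rw [muAux]
    refine add_nonneg (by split_ifs <;> positivity) (Real.sSup_nonneg ?_)
    rintro _ ⟨N', -, rfl⟩
    exact ih N'

lemma muAux_le (n : ℕ) (N : Submodule Λ Y) : muAux Λ n N ≤ n := by
  induction n generalizing N with
  | zero => simp [muAux]
  | succ n ih =>
    rw [muAux]
    have h1 : (open Classical in
        if IndecSub Λ N then (2 : ℝ) ^ (-(subLen Λ N : ℤ)) else 0) ≤ 1 := by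
      split_ifs
      · simpa using two_zpow_neg_le (Nat.zero_le (subLen Λ N))
      · exact zero_le_one
    have h2 : sSup (muAux Λ n '' {N' : Submodule Λ Y | N' < N}) ≤ n := by
      refine Real.sSup_le ?_ (Nat.cast_nonneg n)
      rintro _ ⟨N', -, rfl⟩
      exact ih N'
    push_cast
    linarith

lemma subLen_bot : subLen Λ (⊥ : Submodule Λ Y) = 0 := by simp [subLen]

lemma bddAbove_muAux (n : ℕ) (S : Set (Submodule Λ Y)) : BddAbove (muAux Λ n '' S) := by
  refine ⟨n, ?_⟩
  rintro _ ⟨N', -, rfl⟩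
  exact muAux_le n N'

lemma mu_bot : mu Λ (⊥ : Submodule Λ Y) = 0 := by rw [mu, subLen_bot, muAux]

lemma mu_nonneg (N : Submodule Λ Y) : 0 ≤ mu Λ N := muAux_nonneg _ _

/-- If `p : T → A` is injective on `X ≤ T`, a retraction of `A` onto the image of `X` lifts to a
retraction of `T` onto `X`. -/
lemma exists_retraction_of_comp {X T A : Submodule Λ Y} (hX : X ≤ T) (p : T →ₗ[Λ] Y)
    (hp : ∀ t, p t ∈ A) (hinj : Function.Injective (p ∘ₗ Submodule.inclusion hX))
    (r : A →ₗ[Λ] Y) (hr : ∀ a, r a ∈ LinearMap.range (p ∘ₗ Submodule.inclusion hX))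
    (hrid : ∀ a : A, (a : Y) ∈ LinearMap.range (p ∘ₗ Submodule.inclusion hX) → r a = a) :
    ∃ s : T →ₗ[Λ] Y, (∀ t, s t ∈ X) ∧ ∀ t : T, (t : Y) ∈ X → s t = t := by
  let e := LinearEquiv.ofInjective _ hinj
  refine ⟨X.subtype ∘ₗ e.symm.toLinearMap ∘ₗ r.codRestrict _ hr ∘ₗ p.codRestrict A hp,
    fun t ↦ Submodule.coe_mem _, fun t ht ↦ ?_⟩
  have h1 : r (p.codRestrict A hp t) = p t := hrid _ ⟨⟨t, ht⟩, rfl⟩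
  have h2 : r.codRestrict _ hr (p.codRestrict A hp t) = e ⟨t, ht⟩ := Subtype.ext h1
  simp only [LinearMap.comp_apply, h2]
  simp

lemma exists_projections {A B T : Submodule Λ Y} (hs : A ⊔ B = T) (hi : A ⊓ B = ⊥) :
    ∃ p q : T →ₗ[Λ] Y, (∀ t, p t ∈ A) ∧ (∀ t, q t ∈ B) ∧ ∀ t, p t + q t = t := by
  have hA : A ≤ T := hs ▸ le_sup_left
  have hB : B ≤ T := hs ▸ le_sup_right
  have hc : IsCompl (A.comap T.subtype) (B.comap T.subtype) := by
    have hinj := Submodule.map_injective_of_injective T.injective_subtype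
    refine ⟨disjoint_iff.2 ?_, codisjoint_iff.2 (hinj ?_)⟩
    · rw [← Submodule.comap_inf, hi]
      simp
    · rw [Submodule.map_sup, Submodule.map_comap_subtype, Submodule.map_comap_subtype,
        inf_eq_right.2 hA, inf_eq_right.2 hB, hs, Submodule.map_subtype_top]
  refine ⟨T.subtype ∘ₗ Submodule.projection _ _ hc, T.subtype ∘ₗ Submodule.projection _ _ hc.symm, fun t ↦ ?_, fun t ↦ ?_,
    fun t ↦ ?_⟩
  · exact Submodule.projection_apply_mem hc t
  · exact Submodule.projection_apply_mem hc.symm t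
  · exact congrArg T.subtype (Submodule.projection_add_projection_eq_self hc t)

lemma IndecSub.eq_of_retraction {X Z : Submodule Λ Y} (hZ : IndecSub Λ Z) (hX : X ≤ Z)
    (h0 : X ≠ ⊥) (s : Z →ₗ[Λ] Y) (hs : ∀ z, s z ∈ X) (hid : ∀ z : Z, (z : Y) ∈ X → s z = z) :
    X = Z := by
  have hsup : X ⊔ (LinearMap.ker s).map Z.subtype = Z := by
    refine le_antisymm (sup_le hX (Submodule.map_subtype_le _ _)) fun z hz ↦ ?_
    refine Submodule.mem_sup.2 ⟨s ⟨z, hz⟩, hs _, z - s ⟨z, hz⟩,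
      ⟨⟨z, hz⟩ - ⟨s ⟨z, hz⟩, hX (hs _)⟩, ?_, rfl⟩, by abel⟩
    rw [SetLike.mem_coe, LinearMap.mem_ker, map_sub, hid ⟨s ⟨z, hz⟩, hX (hs _)⟩ (hs _), sub_self]
  have hinf : X ⊓ (LinearMap.ker s).map Z.subtype = ⊥ := by
    rw [eq_bot_iff]
    rintro _ ⟨hzX, z, hz, rfl⟩
    have := hid z hzX
    rw [LinearMap.mem_ker.1 hz] at this
    exact this.symm
  rcases hZ.2 _ _ hX (Submodule.map_subtype_le _ _) hsup hinf with h | h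
  · exact absurd h h0
  · rwa [h, sup_bot_eq] at hsup

/-- The conclusion of Gabriel's main property for the embeddings of `Z` into a direct sum of two
modules, see `IndecSub.gabrielProperty`. -/
def GabrielProperty (Z : Submodule Λ Y) : Prop :=
  ∀ f g : Z →ₗ[Λ] Y, LinearMap.ker f ⊓ LinearMap.ker g = ⊥ →
    Function.Injective f ∨ Function.Injective g ∨
      mu Λ Z + (2 : ℝ) ^ (-(subLen Λ Z : ℤ)) ≤ mu Λ (LinearMap.range f) ∨
      mu Λ Z + (2 : ℝ) ^ (-(subLen Λ Z : ℤ)) ≤ mu Λ (LinearMap.range g)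

/-- `U` is indecomposable and no indecomposable submodule of `T` of length at most `|U|` has a
larger Gabriel-Roiter measure. -/
def IsPilingIn (U T : Submodule Λ Y) : Prop :=
  IndecSub Λ U ∧ ∀ V ≤ T, IndecSub Λ V → subLen Λ V ≤ subLen Λ U → mu Λ V ≤ mu Λ U

lemma IsPilingIn.mono {U T T' : Submodule Λ Y} (h : IsPilingIn U T) (hT : T' ≤ T) :
    IsPilingIn U T' :=
  ⟨h.1, fun V hV ↦ h.2 V (hV.trans hT)⟩

variable [IsNoetherian Λ Y] [IsArtinian Λ Y]

lemma coe_subLen (N : Submodule Λ Y) : (subLen Λ N : ℕ∞) = Module.length Λ N := by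
  rw [subLen, Module.length_submodule]
  exact ENat.natCast_toNat (Submodule.height_lt_top N).ne

lemma subLen_lt {N N' : Submodule Λ Y} (h : N < N') : subLen Λ N < subLen Λ N' := by
  have := Submodule.height_strictMono h
  rw [← Module.length_submodule, ← Module.length_submodule, ← coe_subLen, ← coe_subLen] at this
  exact_mod_cast this

lemma subLen_mono {N N' : Submodule Λ Y} (h : N ≤ N') : subLen Λ N ≤ subLen Λ N' := by
  rcases h.eq_or_lt with rfl | h
  · rfl
  · exact (subLen_lt h).le

lemma eq_of_le_of_subLen_le {N N' : Submodule Λ Y} (h : N ≤ N')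
    (hl : subLen Λ N' ≤ subLen Λ N) : N = N' := by
  by_contra hne
  exact (subLen_lt (lt_of_le_of_ne h hne)).not_ge hl

lemma eq_bot_of_subLen {N : Submodule Λ Y} (h : subLen Λ N = 0) : N = ⊥ :=
  (eq_of_le_of_subLen_le bot_le (by omega)).symm

lemma subLen_eq_of_equiv {N N' : Submodule Λ Y} (e : N ≃ₗ[Λ] N') :
    subLen Λ N = subLen Λ N' := by
  have := e.length_eq
  rw [← coe_subLen, ← coe_subLen] at this
  exact_mod_cast this

lemma subLen_range {N : Submodule Λ Y} {f : N →ₗ[Λ] Y} (hf : Function.Injective f) :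
    subLen Λ (LinearMap.range f) = subLen Λ N :=
  (subLen_eq_of_equiv (LinearEquiv.ofInjective f hf)).symm

lemma subLen_range_lt {N : Submodule Λ Y} {f : N →ₗ[Λ] Y} (hf : ¬ Function.Injective f) :
    subLen Λ (LinearMap.range f) < subLen Λ N := by
  have h := Module.length_eq_add_of_exact (LinearMap.ker f).subtype f.rangeRestrict
    (Submodule.injective_subtype _) f.surjective_rangeRestrict
    (by rw [LinearMap.exact_iff]; simp)
  have hk : Module.length Λ (LinearMap.ker f) ≠ 0 := by
    rw [Ne, Module.length_eq_zero_iff, Submodule.subsingleton_iff_eq_bot]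
    exact fun h ↦ hf (LinearMap.ker_eq_bot.1 h)
  rw [← coe_subLen, ← coe_subLen, ← coe_subLen] at h
  rw [← coe_subLen] at hk
  norm_cast at h hk
  omega

lemma isDyadic_muAux (n : ℕ) (N : Submodule Λ Y) : IsDyadic (subLen Λ N) (muAux Λ n N) := by
  induction n generalizing N with
  | zero => exact IsDyadic.zero _
  | succ n ih =>
    rw [muAux]
    refine IsDyadic.add (by split_ifs; exacts [IsDyadic.unit _, IsDyadic.zero _]) ?_
    have hd : ∀ x ∈ muAux Λ n '' {N' : Submodule Λ Y | N' < N}, IsDyadic (subLen Λ N) x := by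
      rintro _ ⟨N', hN', rfl⟩
      exact (ih N').mono (subLen_lt hN').le
    rcases (muAux Λ n '' {N' : Submodule Λ Y | N' < N}).eq_empty_or_nonempty with he | hne
    · rw [he, Real.sSup_empty]
      exact IsDyadic.zero _
    · exact hd _ (IsDyadic.isGreatest_sSup hd hne (bddAbove_muAux _ _)).1

lemma muAux_succ_of_le {n : ℕ} {N : Submodule Λ Y} (h : subLen Λ N ≤ n) :
    muAux Λ (n + 1) N = muAux Λ n N := by
  induction n generalizing N with
  | zero =>
    obtain rfl := eq_bot_of_subLen (Nat.le_zero.1 h)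
    simp [muAux, not_indecSub_bot]
  | succ n ih =>
    rw [muAux, muAux]
    congr 2
    refine Set.image_congr fun N' hN' ↦ ih ?_
    have := subLen_lt hN'
    omega

lemma muAux_eq_mu {n : ℕ} {N : Submodule Λ Y} (h : subLen Λ N ≤ n) :
    muAux Λ n N = mu Λ N := by
  induction n, h using Nat.le_induction with
  | base => rfl
  | succ n hn ih => rw [muAux_succ_of_le hn, ih]

lemma isDyadic_mu (N : Submodule Λ Y) : IsDyadic (subLen Λ N) (mu Λ N) := isDyadic_muAux _ _

open Classical in
lemma exists_mu_eq {N : Submodule Λ Y} (h0 : N ≠ ⊥) :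
    ∃ N₀ < N, (∀ N' < N, mu Λ N' ≤ mu Λ N₀) ∧
      mu Λ N = (if IndecSub Λ N then (2 : ℝ) ^ (-(subLen Λ N : ℤ)) else 0) + mu Λ N₀ := by
  obtain ⟨l, hl⟩ : ∃ l, subLen Λ N = l + 1 :=
    Nat.exists_eq_succ_of_ne_zero fun h ↦ h0 (eq_bot_of_subLen h)
  have heq : ∀ N' < N, muAux Λ l N' = mu Λ N' := fun N' hN' ↦
    muAux_eq_mu (by have := subLen_lt hN'; omega)
  have hg := IsDyadic.isGreatest_sSup (n := l) (S := muAux Λ l '' {N' : Submodule Λ Y | N' < N})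
    (by
      rintro _ ⟨N', hN', rfl⟩
      exact (isDyadic_muAux l N').mono (by have := subLen_lt hN'; omega))
    ⟨_, ⊥, bot_lt_iff_ne_bot.2 h0, rfl⟩ (bddAbove_muAux _ _)
  obtain ⟨⟨N₀, hN₀, hN₀eq⟩, hub⟩ := hg
  refine ⟨N₀, hN₀, fun N' hN' ↦ ?_, ?_⟩
  · rw [← heq N' hN', ← heq N₀ hN₀, hN₀eq]
    exact hub ⟨N', hN', rfl⟩
  · rw [← heq N₀ hN₀, hN₀eq, mu, ← muAux]
    rw [hl]

lemma mu_mono {N N' : Submodule Λ Y} (h : N' ≤ N) : mu Λ N' ≤ mu Λ N := by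
  classical
  rcases h.eq_or_lt with rfl | h
  · rfl
  obtain ⟨N₀, -, hmax, heq⟩ := exists_mu_eq (ne_bot_of_gt h)
  have : (0 : ℝ) ≤ if IndecSub Λ N then (2 : ℝ) ^ (-(subLen Λ N : ℤ)) else 0 := by
    split_ifs <;> positivity
  linarith [hmax N' h]

lemma IndecSub.mu_add_le {N N' : Submodule Λ Y} (hN : IndecSub Λ N) (h : N' < N) :
    mu Λ N' + (2 : ℝ) ^ (-(subLen Λ N : ℤ)) ≤ mu Λ N := by
  classical
  obtain ⟨N₀, -, hmax, heq⟩ := exists_mu_eq (ne_bot_of_gt h)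
  rw [if_pos hN] at heq
  linarith [hmax N' h]

lemma IndecSub.mu_lt {N N' : Submodule Λ Y} (hN : IndecSub Λ N) (h : N' < N) :
    mu Λ N' < mu Λ N := by
  have := hN.mu_add_le h
  have : (0 : ℝ) < (2 : ℝ) ^ (-(subLen Λ N : ℤ)) := by positivity
  linarith

lemma IndecSub.exists_mu_eq {N : Submodule Λ Y} (hN : IndecSub Λ N) :
    ∃ N₀ < N, mu Λ N = mu Λ N₀ + (2 : ℝ) ^ (-(subLen Λ N : ℤ)) := by
  classical
  obtain ⟨N₀, h, -, heq⟩ := _root_.exists_mu_eq hN.ne_bot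
  rw [if_pos hN, add_comm] at heq
  exact ⟨N₀, h, heq⟩

lemma exists_mu_eq_of_not_indecSub {N : Submodule Λ Y} (h0 : N ≠ ⊥) (hN : ¬ IndecSub Λ N) :
    ∃ N₀ < N, mu Λ N = mu Λ N₀ := by
  classical
  obtain ⟨N₀, h, -, heq⟩ := exists_mu_eq h0
  rw [if_neg hN, zero_add] at heq
  exact ⟨N₀, h, heq⟩

lemma mu_pos {N : Submodule Λ Y} (h0 : N ≠ ⊥) : 0 < mu Λ N := by
  induction N using WellFoundedLT.induction with
  | ind N ih =>
    by_cases hN : IndecSub Λ N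
    · exact (mu_nonneg _).trans_lt (hN.mu_lt (bot_lt_iff_ne_bot.2 h0))
    · obtain ⟨A, -, hA, -, -, -, hA0, -⟩ := exists_decomp h0 hN
      exact (ih A hA hA0).trans_le (mu_mono hA.le)

/-- The Gabriel-Roiter measure of a nonzero module is attained on an indecomposable submodule. -/
lemma exists_indecSub_mu_eq {N : Submodule Λ Y} (h0 : N ≠ ⊥) :
    ∃ X ≤ N, IndecSub Λ X ∧ mu Λ X = mu Λ N := by
  induction N using WellFoundedLT.induction with
  | ind N ih =>
    by_cases hN : IndecSub Λ N
    · exact ⟨N, le_rfl, hN, rfl⟩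
    · obtain ⟨N₀, hlt, heq⟩ := exists_mu_eq_of_not_indecSub h0 hN
      have h0' : N₀ ≠ ⊥ := by
        rintro rfl
        rw [mu_bot] at heq
        exact (mu_pos h0).ne' heq
      obtain ⟨X, hX, hXi, hXm⟩ := ih N₀ hlt h0'
      exact ⟨X, hX.trans hlt.le, hXi, hXm.trans heq.symm⟩

/-- The Gabriel-Roiter measure is invariant under isomorphism. -/
lemma mu_range {N : Submodule Λ Y} {f : N →ₗ[Λ] Y} (hf : Function.Injective f) :
    mu Λ (LinearMap.range f) = mu Λ N := by
  classical
  induction N using WellFoundedLT.induction with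
  | ind N ih =>
    by_cases h0 : N = ⊥
    · have : LinearMap.range f = ⊥ :=
        eq_bot_of_subLen (by rw [subLen_range hf, h0, subLen_bot])
      rw [this, h0]
    have h0' : LinearMap.range f ≠ ⊥ := fun h ↦
      h0 (eq_bot_of_subLen (by rw [← subLen_range hf, h, subLen_bot]))
    obtain ⟨N₀, hlt, hmax, heq⟩ := exists_mu_eq h0
    obtain ⟨R₀, hlt', hmax', heq'⟩ := exists_mu_eq h0'
    rw [heq, heq', subLen_range hf, indecSub_range_iff hf]
    congr 1
    apply le_antisymm
    · obtain ⟨N', hN', rfl⟩ := exists_range_comp_inclusion f hlt'.le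
      have hN'lt : N' < N := by
        refine lt_of_le_of_ne hN' ?_
        rintro rfl
        exact hlt'.ne rfl
      rw [ih N' hN'lt (injective_comp_inclusion hf hN')]
      exact hmax N' hN'lt
    · rw [← ih N₀ hlt (injective_comp_inclusion hf hlt.le)]
      refine hmax' _ (lt_of_le_of_ne (range_comp_inclusion_le f hlt.le) fun h ↦ ?_)
      have := subLen_range (injective_comp_inclusion hf hlt.le)
      rw [h, subLen_range hf] at this
      exact (subLen_lt hlt).ne' this

/-- An indecomposable submodule of maximal Gabriel-Roiter measure is a direct summand. -/
lemma exists_retraction_of_mu_le {X T : Submodule Λ Y} (hXT : X ≤ T) (hX : IndecSub Λ X)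
    (hmu : mu Λ T ≤ mu Λ X)
    (hG : ∀ X' : Submodule Λ Y, IndecSub Λ X' → subLen Λ X' ≤ subLen Λ X → GabrielProperty X') :
    ∃ s : T →ₗ[Λ] Y, (∀ t, s t ∈ X) ∧ ∀ t : T, (t : Y) ∈ X → s t = t := by
  induction T using WellFoundedLT.induction generalizing X with
  | ind T ih =>
    by_cases hT : IndecSub Λ T
    · obtain rfl : X = T := by
        by_contra hne
        exact (hT.mu_lt (lt_of_le_of_ne hXT hne)).not_ge hmu
      exact ⟨X.subtype, fun t ↦ t.2, fun t _ ↦ rfl⟩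
    have hT0 : T ≠ ⊥ := fun h ↦ hX.ne_bot (eq_bot_iff.2 (h ▸ hXT))
    obtain ⟨A, B, hA, hB, hs, hi, -, -⟩ := exists_decomp hT0 hT
    obtain ⟨p, q, hp, hq, hpq⟩ := exists_projections hs hi
    have key : ∀ (A : Submodule Λ Y) (p : T →ₗ[Λ] Y), A < T → (∀ t, p t ∈ A) →
        Function.Injective (p ∘ₗ Submodule.inclusion hXT) →
        ∃ s : T →ₗ[Λ] Y, (∀ t, s t ∈ X) ∧ ∀ t : T, (t : Y) ∈ X → s t = t := by
      intro A p hA hp hinj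
      have hle : LinearMap.range (p ∘ₗ Submodule.inclusion hXT) ≤ A := by
        rintro _ ⟨x, rfl⟩
        exact hp _
      obtain ⟨r, hr, hrid⟩ := ih A hA hle ((indecSub_range_iff hinj).2 hX)
        (by rw [mu_range hinj]; exact (mu_mono hA.le).trans hmu)
        (by rwa [subLen_range hinj])
      exact exists_retraction_of_comp hXT p hp hinj r hr hrid
    have hrange : ∀ (A : Submodule Λ Y) (p : T →ₗ[Λ] Y), A < T → (∀ t, p t ∈ A) →
        ¬ mu Λ X + (2 : ℝ) ^ (-(subLen Λ X : ℤ)) ≤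
          mu Λ (LinearMap.range (p ∘ₗ Submodule.inclusion hXT)) := by
      intro A p hA hp hle
      have h1 : LinearMap.range (p ∘ₗ Submodule.inclusion hXT) ≤ T := by
        rintro _ ⟨x, rfl⟩
        exact hA.le (hp _)
      have := mu_mono h1
      have : (0 : ℝ) < (2 : ℝ) ^ (-(subLen Λ X : ℤ)) := by positivity
      linarith
    rcases hG X hX le_rfl (p ∘ₗ Submodule.inclusion hXT) (q ∘ₗ Submodule.inclusion hXT) (by
      rw [eq_bot_iff]
      rintro x ⟨h1, h2⟩
      have := hpq (Submodule.inclusion hXT x)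
      rw [show p _ = 0 from h1, show q _ = 0 from h2] at this
      exact Subtype.ext (by simpa using this.symm)) with h | h | h | h
    · exact key A p hA hp h
    · exact key B q hB hq h
    · exact absurd h (hrange A p hA hp)
    · exact absurd h (hrange B q hB hq)

/-- If `f` is not injective on an indecomposable module `Z`, but injective on an indecomposable
submodule `X` realising the measure of `Z`, then the image of `f` has larger measure than `Z`. -/
lemma mu_add_le_mu_range_of_injective {X Z : Submodule Λ Y} (hZ : IndecSub Λ Z)
    (hX : IndecSub Λ X) (hXZ : X < Z)
    (hmu : mu Λ Z = mu Λ X + (2 : ℝ) ^ (-(subLen Λ Z : ℤ)))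
    (hG : ∀ X' : Submodule Λ Y, IndecSub Λ X' → subLen Λ X' ≤ subLen Λ X → GabrielProperty X')
    (f : Z →ₗ[Λ] Y) (hf : ¬ Function.Injective f)
    (hfX : Function.Injective (f ∘ₗ Submodule.inclusion hXZ.le)) :
    mu Λ Z + (2 : ℝ) ^ (-(subLen Λ Z : ℤ)) ≤ mu Λ (LinearMap.range f) := by
  have h1 := subLen_range_lt hf
  have h2 := subLen_lt hXZ
  obtain ⟨l, hl⟩ : ∃ l, subLen Λ Z = l + 1 := Nat.exists_eq_succ_of_ne_zero (by omega)
  have hle := mu_mono (range_comp_inclusion_le f hXZ.le)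
  rw [mu_range hfX] at hle
  rcases hle.eq_or_lt with heq | hlt
  · exfalso
    obtain ⟨r, hr, hrid⟩ := exists_retraction_of_mu_le (range_comp_inclusion_le f hXZ.le)
      ((indecSub_range_iff hfX).2 hX) (by rw [mu_range hfX, heq]) (by rwa [subLen_range hfX])
    obtain ⟨s, hs, hid⟩ := exists_retraction_of_comp hXZ.le f (LinearMap.mem_range_self f) hfX r hr hrid
    exact hXZ.ne (hZ.eq_of_retraction hXZ.le hX.ne_bot s hs hid)
  · have := ((isDyadic_mu X).mono (show _ ≤ l by omega)).add_le_of_lt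
      ((isDyadic_mu (LinearMap.range f)).mono (show _ ≤ l by omega)) hlt
    rw [hmu, hl, two_zpow_neg_succ]
    linarith

/-- Gabriel's main property of the Gabriel-Roiter measure: if the indecomposable module `Z`
embeds into a direct sum and no component is injective, then the image under some component has
a larger measure, which moreover does not start with the measure of `Z`. -/
lemma IndecSub.gabrielProperty {Z : Submodule Λ Y} (hZ : IndecSub Λ Z) : GabrielProperty Z := by
  induction hn : subLen Λ Z using Nat.strong_induction_on generalizing Z with
  | _ n ih =>
  subst hn
  intro f g hfg
  by_cases hf : Function.Injective f
  · exact Or.inl hf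
  by_cases hg : Function.Injective g
  · exact Or.inr (Or.inl hg)
  right; right
  obtain ⟨Z₀, hZ₀, hmu⟩ := hZ.exists_mu_eq
  have h0 : Z₀ ≠ ⊥ := by
    rintro rfl
    have hK0 : (LinearMap.ker f).map Z.subtype ≠ ⊥ := fun h ↦ hf <| LinearMap.ker_eq_bot.1 <|
      Submodule.map_injective_of_injective Z.injective_subtype (by rw [h, Submodule.map_bot])
    have hK : (LinearMap.ker f).map Z.subtype < Z := by
      refine lt_of_le_of_ne (Submodule.map_subtype_le _ _) fun h ↦ hg (LinearMap.ker_eq_bot.1 ?_)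
      have : LinearMap.ker f = ⊤ := Submodule.map_injective_of_injective Z.injective_subtype
        (by rw [h, Submodule.map_subtype_top])
      rwa [this, top_inf_eq] at hfg
    have h1 := hZ.mu_add_le hK
    have h2 := mu_pos hK0
    rw [mu_bot] at hmu
    linarith
  obtain ⟨X, hXZ₀, hX, hXmu⟩ := exists_indecSub_mu_eq h0
  have hXZ := hXZ₀.trans_lt hZ₀
  rw [← hXmu] at hmu
  have hlen := subLen_lt hXZ
  have hG : ∀ X' : Submodule Λ Y, IndecSub Λ X' → subLen Λ X' ≤ subLen Λ X →
      GabrielProperty X' := fun X' hX' hl ↦ ih _ (hl.trans_lt hlen) hX' rfl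
  have hmu2 : mu Λ Z + (2 : ℝ) ^ (-(subLen Λ Z : ℤ)) ≤
      mu Λ X + (2 : ℝ) ^ (-(subLen Λ X : ℤ)) := by
    have := two_zpow_neg_le (show subLen Λ X + 1 ≤ subLen Λ Z from hlen)
    rw [two_zpow_neg_succ] at this
    linarith
  rcases hG X hX le_rfl (f ∘ₗ Submodule.inclusion hXZ.le) (g ∘ₗ Submodule.inclusion hXZ.le) (by
    rw [LinearMap.ker_comp, LinearMap.ker_comp, ← Submodule.comap_inf, hfg]
    exact Submodule.ker_inclusion _ _ _) with h | h | h | h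
  · exact Or.inl (mu_add_le_mu_range_of_injective hZ hX hXZ hmu hG f hf h)
  · exact Or.inr (mu_add_le_mu_range_of_injective hZ hX hXZ hmu hG g hg h)
  · exact Or.inl ((hmu2.trans h).trans (mu_mono (range_comp_inclusion_le f _)))
  · exact Or.inr ((hmu2.trans h).trans (mu_mono (range_comp_inclusion_le g _)))

/-- The Gabriel-Roiter measure of a module starts with that of any piling submodule. -/
lemma IsPilingIn.mu_lt {U T : Submodule Λ Y} (h : IsPilingIn U T) {X : Submodule Λ Y}
    (hX : X ≤ T) : mu Λ X < mu Λ U + (2 : ℝ) ^ (-(subLen Λ U : ℤ)) := by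
  have hp : (0 : ℝ) < (2 : ℝ) ^ (-(subLen Λ U : ℤ)) := by positivity
  induction X using WellFoundedLT.induction with
  | ind X ih =>
    by_cases h0 : X = ⊥
    · rw [h0, mu_bot]
      have := mu_nonneg (Λ := Λ) U
      linarith
    by_cases hXi : IndecSub Λ X
    · rcases le_or_gt (subLen Λ X) (subLen Λ U) with hl | hl
      · have := h.2 X hX hXi hl
        linarith
      · obtain ⟨X₀, hlt, hmu⟩ := hXi.exists_mu_eq
        have hX₀ := ih X₀ hlt (hlt.le.trans hX)
        have hlen := subLen_lt hlt
        obtain ⟨l, hl'⟩ : ∃ l, subLen Λ X = l + 1 := Nat.exists_eq_succ_of_ne_zero (by omega)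
        have h1 := ((isDyadic_mu X₀).mono (show _ ≤ l by omega)).add_le_of_lt
          (((isDyadic_mu U).add (IsDyadic.unit _)).mono (show _ ≤ l by omega)) hX₀
        have hpl : (0 : ℝ) < (2 : ℝ) ^ (-(l : ℤ)) := by positivity
        rw [hmu, hl', two_zpow_neg_succ]
        linarith
    · obtain ⟨X₀, hlt, hmu⟩ := exists_mu_eq_of_not_indecSub h0 hXi
      rw [hmu]
      exact ih X₀ hlt (hlt.le.trans hX)

lemma IsPilingIn.exists_le_mu_eq {U T : Submodule Λ Y} (h : IsPilingIn U T) {X : Submodule Λ Y}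
    (hX : X ≤ T) (hmu : mu Λ U ≤ mu Λ X) :
    ∃ V ≤ X, IndecSub Λ V ∧ subLen Λ V ≤ subLen Λ U ∧ mu Λ V = mu Λ U := by
  induction X using WellFoundedLT.induction with
  | ind X ih =>
    have h0 : X ≠ ⊥ := by
      rintro rfl
      rw [mu_bot] at hmu
      exact hmu.not_gt (mu_pos h.1.ne_bot)
    have key : ∀ X₀ < X, mu Λ U ≤ mu Λ X₀ →
        ∃ V ≤ X, IndecSub Λ V ∧ subLen Λ V ≤ subLen Λ U ∧ mu Λ V = mu Λ U := by
      intro X₀ hlt hle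
      obtain ⟨V, hV, h'⟩ := ih X₀ hlt (hlt.le.trans hX) hle
      exact ⟨V, hV.trans hlt.le, h'⟩
    by_cases hXi : IndecSub Λ X
    · rcases le_or_gt (subLen Λ X) (subLen Λ U) with hl | hl
      · exact ⟨X, le_rfl, hXi, hl, (h.2 X hX hXi hl).antisymm hmu⟩
      · obtain ⟨X₀, hlt, hmu'⟩ := hXi.exists_mu_eq
        refine key X₀ hlt ?_
        by_contra! hcon
        have hlen := subLen_lt hlt
        obtain ⟨l, hl'⟩ : ∃ l, subLen Λ X = l + 1 := Nat.exists_eq_succ_of_ne_zero (by omega)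
        have h1 := ((isDyadic_mu X₀).mono (show _ ≤ l by omega)).add_le_of_lt
          ((isDyadic_mu U).mono (show _ ≤ l by omega)) hcon
        have hpl : (0 : ℝ) < (2 : ℝ) ^ (-(l : ℤ)) := by positivity
        rw [hl', two_zpow_neg_succ] at hmu'
        linarith
    · obtain ⟨X₀, hlt, hmu'⟩ := exists_mu_eq_of_not_indecSub h0 hXi
      exact key X₀ hlt (hmu'.symm ▸ hmu)

lemma IsPilingSub.isPilingIn {U : Submodule Λ Y} (hU : IsPilingSub Λ U) (T : Submodule Λ Y) :
    IsPilingIn U T := by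
  refine ⟨hU.1, fun V _ hV hl ↦ hU.2 V hV ?_⟩
  rw [← Module.length_submodule, ← Module.length_submodule, ← coe_subLen, ← coe_subLen]
  exact_mod_cast hl

end GabrielRoiter

section Filtration

variable {Λ : Type u} [Ring Λ] {M : Type v} [AddCommGroup M] [Module Λ M]
  {Y : Type v} [AddCommGroup Y] [Module Λ Y]

variable (M) in
/-- `A ≤ B` are submodules with `B / A` isomorphic to `M`. -/
def IsStep (A B : Submodule Λ Y) : Prop :=
  A ≤ B ∧ Nonempty ((B ⧸ A.comap B.subtype) ≃ₗ[Λ] M)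

namespace IsStep

variable {A B V : Submodule Λ Y}

lemma exists_map (h : IsStep M A B) : ∃ φ : B →ₗ[Λ] M, Function.Surjective φ ∧
    LinearMap.ker φ = A.comap B.subtype := by
  obtain ⟨-, ⟨e⟩⟩ := h
  refine ⟨e.toLinearMap ∘ₗ (A.comap B.subtype).mkQ,
    e.surjective.comp (Submodule.mkQ_surjective _), ?_⟩
  rw [LinearMap.ker_comp, LinearEquiv.ker, Submodule.comap_bot, Submodule.ker_mkQ]

lemma lt [Nontrivial M] (h : IsStep M A B) : A < B := by
  refine lt_of_le_of_ne h.1 ?_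
  rintro rfl
  obtain ⟨-, ⟨e⟩⟩ := h
  have hs : Subsingleton (A ⧸ A.comap A.subtype) := by
    rw [Submodule.Quotient.subsingleton_iff, Submodule.comap_subtype_self]
  have := e.symm.toEquiv.subsingleton
  exact not_subsingleton M this

lemma sup_of_inf (h : IsStep M (B ⊓ A) B) : IsStep M A (B ⊔ A) := by
  obtain ⟨-, ⟨e⟩⟩ := h
  refine ⟨le_sup_right, ⟨(LinearMap.quotientInfEquivSupQuotient B A).symm ≪≫ₗ
    Submodule.quotEquivOfEq _ _ ?_ ≪≫ₗ e⟩⟩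
  rw [Submodule.comap_inf]

lemma inf_of_sup (h : IsStep M A (B ⊔ A)) : IsStep M (B ⊓ A) B := by
  obtain ⟨-, ⟨e⟩⟩ := h
  refine ⟨inf_le_left, ⟨Submodule.quotEquivOfEq _ _ ?_ ≪≫ₗ
    LinearMap.quotientInfEquivSupQuotient B A ≪≫ₗ e⟩⟩
  rw [Submodule.comap_inf]

lemma sup_left (h : IsStep M A B) (hV : V ⊓ B ≤ A) : IsStep M (V ⊔ A) (V ⊔ B) := by
  have h1 : B ⊓ (V ⊔ A) = A := by
    rw [inf_comm, sup_comm, sup_inf_assoc_of_le _ h.1, sup_eq_left.2 hV]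
  have h2 : B ⊔ (V ⊔ A) = V ⊔ B := by
    rw [sup_left_comm, sup_eq_left.2 h.1]
  have := sup_of_inf (A := V ⊔ A) (B := B) (by rwa [h1])
  rwa [h2] at this

lemma subLen_eq [IsNoetherian Λ Y] [IsArtinian Λ Y] [IsNoetherian Λ M] [IsArtinian Λ M]
    (h : IsStep M A B) : subLen Λ B = subLen Λ A + subLen Λ (⊤ : Submodule Λ M) := by
  obtain ⟨φ, hφ, hk⟩ := h.exists_map
  have := Module.length_eq_add_of_exact (Submodule.inclusion h.1) φ
    (Submodule.inclusion_injective _) hφ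
    (by rw [LinearMap.exact_iff, hk, Submodule.range_inclusion])
  rw [← coe_subLen, ← coe_subLen, ← Module.length_top, ← coe_subLen] at this
  exact_mod_cast this

lemma eq_zero_of_isBrick (hM : IsBrick Λ M) (h : IsStep M A B) (φ : B →ₗ[Λ] M)
    (hφ : ¬ Function.Surjective φ) (hA : ∀ x : B, (x : Y) ∈ A → φ x = 0) : φ = 0 := by
  obtain ⟨-, ⟨e⟩⟩ := h
  have hk : A.comap B.subtype ≤ LinearMap.ker φ := fun x hx ↦ hA x hx
  have h0 : (A.comap B.subtype).liftQ φ hk ∘ₗ e.symm.toLinearMap = 0 := by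
    by_contra hne
    refine hφ fun y ↦ ?_
    obtain ⟨x, hx⟩ := (hM.2 _ hne).2 y
    obtain ⟨b, hb⟩ := Submodule.mkQ_surjective _ (e.symm x)
    refine ⟨b, ?_⟩
    rw [← hx, LinearMap.comp_apply, LinearEquiv.coe_coe, ← hb, Submodule.mkQ_apply,
      Submodule.liftQ_apply]
  ext x
  have := LinearMap.congr_fun h0 (e (Submodule.Quotient.mk x))
  simpa using this

end IsStep

lemma IsIrreducibleHom.exists_retraction [IsNoetherian Λ Y] [IsArtinian Λ Y]
    {A B W : Submodule Λ Y} {h : A ≤ B} (hirr : IsIrreducibleHom Λ (Submodule.inclusion h))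
    (hA : A ≤ W) (hW : W < B) :
    ∃ r : W →ₗ[Λ] Y, (∀ w, r w ∈ A) ∧ ∀ w : W, (w : Y) ∈ A → r w = w := by
  rcases hirr.2.2 W (isFiniteLength_iff_isNoetherian_isArtinian.2 ⟨inferInstance, inferInstance⟩)
    (Submodule.inclusion hA) (Submodule.inclusion hW.le) rfl with ⟨r, hr⟩ | ⟨s, hs⟩
  · refine ⟨A.subtype ∘ₗ r, fun w ↦ (r w).2, fun w hw ↦ ?_⟩
    have := LinearMap.congr_fun hr ⟨w, hw⟩
    exact congrArg Subtype.val this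
  · refine absurd (fun b hb ↦ ?_) hW.not_ge
    have := congrArg Subtype.val (LinearMap.congr_fun hs ⟨b, hb⟩)
    have h2 : ((s ⟨b, hb⟩ : W) : Y) = b := this
    exact h2 ▸ (s ⟨b, hb⟩).2

variable (M) in
/-- The chain `C 0 ⊂ C 1 ⊂ ⋯ ⊂ C m = Y` is a homogeneous `M`-filtration, and the only
`M`-filtration of `Y` of this length. Irreducibility of the inclusions enters only by way of
the splitting of `C k` in the modules strictly below `C (k + 1)`. -/
structure IsUniqueHomogChain (C : ℕ → Submodule Λ Y) (m : ℕ) : Prop where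
  bot : C 0 = ⊥
  top : C m = ⊤
  step : ∀ k < m, IsStep M (C k) (C (k + 1))
  indec : ∀ k, 1 ≤ k → k ≤ m → IndecSub Λ (C k)
  retraction : ∀ k, 1 ≤ k → k < m → ∀ W, C k ≤ W → W < C (k + 1) →
    ∃ r : W →ₗ[Λ] Y, (∀ w, r w ∈ C k) ∧ ∀ w : W, (w : Y) ∈ C k → r w = w
  unique : ∀ C' : ℕ → Submodule Λ Y, C' 0 = ⊥ → C' m = ⊤ →
    (∀ k < m, IsStep M (C' k) (C' (k + 1))) → ∀ k ≤ m, C' k = C k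

namespace IsUniqueHomogChain

variable {C : ℕ → Submodule Λ Y} {m : ℕ}

lemma le (H : IsUniqueHomogChain M C m) {i j : ℕ} (hij : i ≤ j) (hj : j ≤ m) : C i ≤ C j := by
  induction j, hij using Nat.le_induction with
  | base => rfl
  | succ j _ ih => exact (ih (by omega)).trans (H.step j hj).1

lemma eq_zero_of_not_surjective (H : IsUniqueHomogChain M C m) (hM : IsBrick Λ M) {j : ℕ}
    (hj : j ≤ m) (φ : C j →ₗ[Λ] M) (hφ : ¬ Function.Surjective φ) : φ = 0 := by
  have key : ∀ k ≤ j, ∀ x : C j, (x : Y) ∈ C k → φ x = 0 := by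
    intro k
    induction k with
    | zero =>
      intro _ x hx
      rw [H.bot, Submodule.mem_bot] at hx
      rw [show x = 0 from Subtype.ext hx, map_zero]
    | succ k ih =>
      intro hk x hx
      have h0 := (H.step k (by omega)).eq_zero_of_isBrick hM
        (φ ∘ₗ Submodule.inclusion (H.le hk hj)) (fun h ↦ hφ (Function.Surjective.of_comp h))
        (fun y hy ↦ ih (by omega) _ hy)
      exact LinearMap.congr_fun h0 ⟨x, hx⟩
  ext x
  exact key j le_rfl x x.2

/-- A submodule `V` of `C (n + 1)` with `V + C n = C (n + 1)` and `V ∩ C n = C i` has to be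
`C (i + 1)`: otherwise it yields another filtration. -/
lemma eq_of_sup_eq_of_inf_eq (H : IsUniqueHomogChain M C m) {i n : ℕ} (hin : i ≤ n)
    (hn : n < m) {V : Submodule Λ Y} (hsup : V ⊔ C n = C (n + 1)) (hinf : V ⊓ C n = C i) :
    V = C (i + 1) := by
  have hiV : C i ≤ V := hinf ▸ inf_le_left
  have hVs : V ⊔ C i = V := sup_eq_left.2 hiV
  have hVstep : IsStep M (C i) V := by
    rw [← hinf]
    exact IsStep.inf_of_sup (by rw [hsup]; exact H.step n hn)
  let C' : ℕ → Submodule Λ Y := fun k ↦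
    if k ≤ i then C k else if k ≤ n + 1 then V ⊔ C (k - 1) else C k
  have hlow : ∀ k ≤ i, C' k = C k := fun k hk ↦ if_pos hk
  have hmid : ∀ k, i ≤ k → k ≤ n → C' (k + 1) = V ⊔ C k := fun k h1 h2 ↦ by
    simp [C', show ¬ k + 1 ≤ i by omega, h2]
  have hhigh : ∀ k, n + 1 ≤ k → C' k = C k := fun k hk ↦ by
    rcases hk.eq_or_lt with rfl | hk
    · rw [hmid n hin le_rfl, hsup]
    · simp [C', show ¬ k ≤ i by omega, show ¬ k ≤ n + 1 by omega]
  have h := H.unique C' (by rw [hlow 0 (by omega), H.bot]) (by rw [hhigh m (by omega), H.top]) ?_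
    (i + 1) (by omega)
  · rw [← h, hmid i le_rfl hin, hVs]
  intro k hk
  rcases lt_trichotomy k i with h | rfl | h
  · rw [hlow k h.le, hlow (k + 1) h]
    exact H.step k hk
  · rwa [hlow k le_rfl, hmid k le_rfl hin, hVs]
  · by_cases hkn : k ≤ n
    · obtain ⟨l, rfl⟩ : ∃ l, k = l + 1 := Nat.exists_eq_succ_of_ne_zero (by omega)
      rw [hmid l (by omega) (by omega), hmid (l + 1) (by omega) hkn]
      refine (H.step l (by omega)).sup_left ?_
      exact (inf_le_inf_left V (H.le hkn hn.le)).trans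
        (hinf.le.trans (H.le (by omega) (by omega)))
    · rw [hhigh k (by omega), hhigh (k + 1) (by omega)]
      exact H.step k hk

variable [IsNoetherian Λ Y] [IsArtinian Λ Y]

/-- Every module which embeds into `M` as a proper submodule has smaller measure than `C 1`. -/
lemma mu_lt_of_not_surjective (H : IsUniqueHomogChain M C m) (hm : 1 ≤ m) {W : Submodule Λ Y}
    (α : W →ₗ[Λ] M) (hinj : Function.Injective α) (hsurj : ¬ Function.Surjective α) :
    mu Λ W < mu Λ (C 1) := by
  obtain ⟨φ, hφ, hk⟩ := (H.step 0 hm).exists_map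
  have hk' : LinearMap.ker φ = ⊥ := by
    rw [hk, H.bot, Submodule.comap_bot, Submodule.ker_subtype]
  let e : C (0 + 1) ≃ₗ[Λ] M := LinearEquiv.ofBijective φ ⟨LinearMap.ker_eq_bot.1 hk', hφ⟩
  let γ : W →ₗ[Λ] Y := (C (0 + 1)).subtype ∘ₗ e.symm.toLinearMap ∘ₗ α
  have hγ : Function.Injective γ :=
    (Submodule.injective_subtype _).comp (e.symm.injective.comp hinj)
  rw [← mu_range hγ]
  refine (H.indec 1 le_rfl hm).mu_lt (lt_of_le_of_ne ?_ fun h ↦ hsurj fun y ↦ ?_)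
  · rintro _ ⟨x, rfl⟩
    exact (e.symm (α x)).2
  · have hy : ((e.symm y : C (0 + 1)) : Y) ∈ LinearMap.range γ := by
      rw [h]
      exact (e.symm y).2
    obtain ⟨x, hx⟩ := hy
    exact ⟨x, e.symm.injective (Subtype.ext hx)⟩

/-- An indecomposable submodule `N` of `C (n + 1)` of measure at least `μ(C 1)` which does not
generate `C (n + 1)` together with `C n` embeds into `C n`, unless `μ(C n)` exceeds `μ(N)` and
does not start with it. -/
lemma mu_add_le_or_exists_embedding (H : IsUniqueHomogChain M C m) (hM : IsBrick Λ M) {n : ℕ}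
    (hn1 : 1 ≤ n) (hn : n < m) {N : Submodule Λ Y} (hN : IndecSub Λ N) (hNT : N ≤ C (n + 1))
    (hsup : N ⊔ C n ≠ C (n + 1)) (hmu : mu Λ (C 1) ≤ mu Λ N) :
    mu Λ N + (2 : ℝ) ^ (-(subLen Λ N : ℤ)) ≤ mu Λ (C n) ∨
      ∃ f : N →ₗ[Λ] Y, Function.Injective f ∧ LinearMap.range f ≤ C n ∧
        ∀ j ≤ m, LinearMap.range f = C j → N = C j := by
  have hpos : (0 : ℝ) < (2 : ℝ) ^ (-(subLen Λ N : ℤ)) := by positivity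
  have hWT : N ⊔ C n < C (n + 1) :=
    lt_of_le_of_ne (sup_le hNT (H.step n hn).1) hsup
  obtain ⟨r, hr, hrid⟩ := H.retraction n hn1 hn _ le_sup_right hWT
  have hNW : N ≤ N ⊔ C n := le_sup_left
  let f : N →ₗ[Λ] Y := r ∘ₗ Submodule.inclusion hNW
  let g : N →ₗ[Λ] Y := N.subtype - f
  have hfS : ∀ x, f x ∈ C n := fun x ↦ hr _
  have hfg : ∀ x : N, f x + g x = x := fun x ↦ by simp [g]
  have hgW : LinearMap.range g ≤ N ⊔ C n := by
    rintro _ ⟨x, rfl⟩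
    exact Submodule.sub_mem _ (hNW x.2) (Submodule.mem_sup_right (hfS x))
  have hgS : ∀ x, g x ∈ C n → g x = 0 := by
    intro x hx
    have h1 : r ⟨g x, hgW ⟨x, rfl⟩⟩ = g x := hrid _ hx
    have h2 : r ⟨f x, Submodule.mem_sup_right (hfS x)⟩ = f x := hrid _ (hfS x)
    have h3 : (⟨g x, hgW ⟨x, rfl⟩⟩ : (N ⊔ C n : Submodule Λ Y)) =
        Submodule.inclusion hNW x - ⟨f x, Submodule.mem_sup_right (hfS x)⟩ := Subtype.ext rfl
    rw [← h1, h3, map_sub, h2]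
    exact sub_self (f x)
  obtain ⟨π, hπ, hπk⟩ := (H.step n hn).exists_map
  have hgT : LinearMap.range g ≤ C (n + 1) := hgW.trans hWT.le
  let α : LinearMap.range g →ₗ[Λ] M := π ∘ₗ Submodule.inclusion hgT
  have hαinj : Function.Injective α := by
    rw [← LinearMap.ker_eq_bot, eq_bot_iff]
    rintro ⟨_, x, rfl⟩ hx
    have : Submodule.inclusion hgT ⟨g x, x, rfl⟩ ∈ LinearMap.ker π := hx
    rw [hπk] at this
    exact Subtype.ext (hgS x this)
  have hαsurj : ¬ Function.Surjective α := by
    refine fun h ↦ hWT.not_ge fun t ht ↦ ?_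
    obtain ⟨w, hw⟩ := h (π ⟨t, ht⟩)
    have : (⟨t, ht⟩ : C (n + 1)) - Submodule.inclusion hgT w ∈ LinearMap.ker π := by
      rw [LinearMap.mem_ker, map_sub, sub_eq_zero]
      exact hw.symm
    rw [hπk] at this
    have h4 : t - w ∈ C n := this
    have := Submodule.add_mem _ (Submodule.mem_sup_right h4) (hgW w.2)
    rwa [sub_add_cancel] at this
  have hmug : mu Λ (LinearMap.range g) < mu Λ N :=
    (H.mu_lt_of_not_surjective (by omega) α hαinj hαsurj).trans_le hmu
  have hker : LinearMap.ker f ⊓ LinearMap.ker g = ⊥ := by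
    rw [eq_bot_iff]
    rintro x ⟨h1, h2⟩
    have := hfg x
    rw [show f x = 0 from h1, show g x = 0 from h2, add_zero] at this
    exact Subtype.ext this.symm
  have hfr : LinearMap.range f ≤ C n := by
    rintro _ ⟨x, rfl⟩
    exact hfS x
  rcases hN.gabrielProperty f g hker with h | h | h | h
  · refine Or.inr ⟨f, h, hfr, fun j hj hfj ↦ ?_⟩
    let e : N ≃ₗ[Λ] C j := LinearEquiv.ofInjective f h ≪≫ₗ LinearEquiv.ofEq _ _ hfj
    have h0 := H.eq_zero_of_not_surjective hM hj (α ∘ₗ g.rangeRestrict ∘ₗ e.symm.toLinearMap)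
      (fun hs ↦ hαsurj (Function.Surjective.of_comp hs))
    have hg0 : ∀ x, f x = x := by
      intro x
      have h1 : α (g.rangeRestrict (e.symm (e x))) = 0 := LinearMap.congr_fun h0 (e x)
      rw [e.symm_apply_apply] at h1
      have h3 : g x = 0 := congrArg Subtype.val (hαinj (h1.trans (map_zero α).symm))
      have h4 := hfg x
      rwa [h3, add_zero] at h4
    rw [← hfj]
    refine le_antisymm (fun x hx ↦ ⟨⟨x, hx⟩, hg0 _⟩) ?_
    rintro _ ⟨x, rfl⟩
    rw [hg0 x]
    exact x.2
  · rw [mu_range h] at hmug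
    exact absurd hmug (lt_irrefl _)
  · exact Or.inl (h.trans (mu_mono hfr))
  · linarith

lemma mu_le (H : IsUniqueHomogChain M C m) {i j : ℕ} (hij : i ≤ j) (hj : j ≤ m) :
    mu Λ (C i) ≤ mu Λ (C j) :=
  mu_mono (H.le hij hj)

variable [IsNoetherian Λ M] [IsArtinian Λ M]

/-- If `V + C n = C (n + 1)`, then `V ∩ C n` is shorter than `V` by the length of `M`. -/
lemma subLen_inf (H : IsUniqueHomogChain M C m) {n : ℕ} (hn : n < m) {V : Submodule Λ Y}
    (hsup : V ⊔ C n = C (n + 1)) :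
    subLen Λ V = subLen Λ (V ⊓ C n) + subLen Λ (⊤ : Submodule Λ M) :=
  (IsStep.inf_of_sup (by rw [hsup]; exact H.step n hn)).subLen_eq

/-- The members of the chain are piling submodules, determined by their measure. -/
lemma eq_of_mu_le (H : IsUniqueHomogChain M C m) (hM : IsBrick Λ M) {n : ℕ} (hn1 : 1 ≤ n)
    (hn : n ≤ m) {j : ℕ} (hj1 : 1 ≤ j) (hjn : j ≤ n) {V : Submodule Λ Y} (hVn : V ≤ C n)
    (hV : IndecSub Λ V) (hlen : subLen Λ V ≤ subLen Λ (C j)) (hmu : mu Λ (C j) ≤ mu Λ V) :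
    V = C j := by
  have := hM.1
  have : Nontrivial M := ⟨this.choose, 0, this.choose_spec⟩
  induction n, hn1 using Nat.le_induction generalizing j V with
  | base =>
    obtain rfl : j = 1 := by omega
    by_contra hne
    exact ((H.indec 1 le_rfl hn).mu_lt (lt_of_le_of_ne hVn hne)).not_ge hmu
  | succ n hn1 ihn =>
    induction j using Nat.strong_induction_on generalizing V with
    | _ j ihj =>
    rcases hjn.eq_or_lt with rfl | hjn
    · by_contra hne
      exact ((H.indec _ hj1 hn).mu_lt (lt_of_le_of_ne hVn hne)).not_ge hmu
    obtain ⟨i, rfl⟩ : ∃ i, j = i + 1 := Nat.exists_eq_succ_of_ne_zero (by omega)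
    by_cases hsup : V ⊔ C n = C (n + 1)
    · have hiV : C i ≤ V := by
        rcases Nat.eq_zero_or_pos i with rfl | hi
        · rw [H.bot]
          exact bot_le
        have hpil : IsPilingIn (C i) (C (n + 1)) := by
          refine ⟨H.indec i hi (by omega), fun X hX hXi hXl ↦ ?_⟩
          by_contra! hlt
          rw [ihj i (by omega) hi (by omega) hX hXi hXl hlt.le] at hlt
          exact lt_irrefl _ hlt
        obtain ⟨X, hXV, hXi, hXl, hXmu⟩ :=
          hpil.exists_le_mu_eq hVn ((H.mu_le (by omega) (by omega)).trans hmu)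
        rw [← ihj i (by omega) hi (by omega) (hXV.trans hVn) hXi hXl hXmu.ge]
        exact hXV
      refine H.eq_of_sup_eq_of_inf_eq (by omega) hn hsup
        (eq_of_le_of_subLen_le (le_inf hiV (H.le (by omega) (by omega))) ?_).symm
      have h1 := H.subLen_inf hn hsup
      have h2 := (H.step i (by omega)).subLen_eq
      omega
    · rcases H.mu_add_le_or_exists_embedding hM hn1 hn hV hVn hsup
        ((H.mu_le hj1 (by omega)).trans hmu) with h | ⟨f, hf, hfn, hfC⟩
      · have hpil : IsPilingIn (C (i + 1)) (C n) := by
          refine ⟨H.indec _ hj1 (by omega), fun X hX hXi hXl ↦ ?_⟩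
          by_contra! hlt
          rw [ihn (by omega) hj1 (by omega) hX hXi hXl hlt.le] at hlt
          exact lt_irrefl _ hlt
        have h1 := hpil.mu_lt le_rfl
        have h2 := two_zpow_neg_le hlen
        linarith
      · exact hfC _ (by omega) (ihn (by omega) hj1 (by omega) hfn ((indecSub_range_iff hf).2 hV)
          (by rwa [subLen_range hf]) (by rwa [mu_range hf]))

lemma isPilingIn (H : IsUniqueHomogChain M C m) (hM : IsBrick Λ M) {n j : ℕ} (hj1 : 1 ≤ j)
    (hjn : j ≤ n) (hn : n ≤ m) : IsPilingIn (C j) (C n) := by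
  refine ⟨H.indec j hj1 (by omega), fun X hX hXi hXl ↦ ?_⟩
  by_contra! hlt
  rw [H.eq_of_mu_le hM (by omega) hn hj1 hjn hX hXi hXl hlt.le] at hlt
  exact lt_irrefl _ hlt

/-- The only piling submodules of `C n` of length at least `|M|` are the members of the chain. -/
lemma exists_eq_of_isPilingIn (H : IsUniqueHomogChain M C m) (hM : IsBrick Λ M) {n : ℕ}
    (hn1 : 1 ≤ n) (hn : n ≤ m) {U : Submodule Λ Y} (hUn : U ≤ C n) (hU : IsPilingIn U (C n))
    (hlen : subLen Λ (⊤ : Submodule Λ M) ≤ subLen Λ U) :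
    ∃ j, 1 ≤ j ∧ j ≤ n ∧ U = C j := by
  have hlen1 : subLen Λ (C 1) = subLen Λ (⊤ : Submodule Λ M) := by
    rw [(H.step 0 (by omega)).subLen_eq, H.bot, subLen_bot, zero_add]
  induction n, hn1 using Nat.le_induction generalizing U with
  | base => exact ⟨1, le_rfl, le_rfl, eq_of_le_of_subLen_le hUn (by omega)⟩
  | succ n hn1 ih =>
    by_cases hUT : U = C (n + 1)
    · exact ⟨n + 1, by omega, le_rfl, hUT⟩
    have hltT : subLen Λ U < subLen Λ (C (n + 1)) := subLen_lt (lt_of_le_of_ne hUn hUT)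
    obtain ⟨j, hj1, hjn, hjl, hjl'⟩ : ∃ j, 1 ≤ j ∧ j ≤ n ∧ subLen Λ (C j) ≤ subLen Λ U ∧
        subLen Λ U < subLen Λ (C (j + 1)) := by
      by_contra! hcon
      have : ∀ j, 1 ≤ j → j ≤ n + 1 → subLen Λ (C j) ≤ subLen Λ U := by
        intro j hj1
        induction j, hj1 using Nat.le_induction with
        | base => intro _; omega
        | succ j hj1 ihj => exact fun h ↦ hcon j hj1 (by omega) (ihj (by omega))
      exact hltT.not_ge (this (n + 1) (by omega) le_rfl)
    have hjT := H.isPilingIn hM hj1 (show j ≤ n + 1 by omega) hn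
    have hjmu : mu Λ (C j) ≤ mu Λ U :=
      hU.2 _ (H.le (by omega) hn) (H.indec j hj1 (by omega)) hjl
    obtain ⟨V, hVU, hVi, hVl, hVmu⟩ := hjT.exists_le_mu_eq hUn hjmu
    obtain rfl := H.eq_of_mu_le hM (by omega) hn hj1 (by omega) (hVU.trans hUn) hVi hVl hVmu.ge
    have hsup : U ⊔ C n ≠ C (n + 1) := by
      intro hsup
      have h1 := H.subLen_inf hn hsup
      have h2 := (H.step j (by omega)).subLen_eq
      have h3 := subLen_mono (le_inf hVU (H.le hjn (by omega)))
      omega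
    rcases H.mu_add_le_or_exists_embedding hM hn1 hn hU.1 hUn hsup
      ((H.mu_le hj1 (by omega)).trans hjmu) with h | ⟨f, hf, hfn, hfC⟩
    · exact absurd h (hU.mu_lt (H.step n hn).1).not_ge
    · obtain ⟨l, hl1, hln, hl⟩ := ih (by omega) hfn
        ⟨(indecSub_range_iff hf).2 hU.1, fun X hX hXi hXl ↦ by
          rw [mu_range hf]
          rw [subLen_range hf] at hXl
          exact hU.2 X (hX.trans (H.step n hn).1) hXi hXl⟩
        (by rwa [subLen_range hf])
      exact ⟨l, hl1, by omega, hfC l (by omega) hl⟩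

end IsUniqueHomogChain

lemma IsMFiltration.isStep {m : ℕ} {c : Fin (m + 1) → Submodule Λ Y} (hc : IsMFiltration Λ M c)
    (i : Fin m) : IsStep M (c i.castSucc) (c i.succ) :=
  ⟨(hc.lt i).le, hc.quot i⟩

lemma isUniqueHomogChain_of_isHomogMFiltration [Nontrivial M] [IsNoetherian Λ Y]
    [IsArtinian Λ Y] {m : ℕ} {c : Fin (m + 1) → Submodule Λ Y} (hc : IsHomogMFiltration Λ M c)
    (huniq : ∀ (m' : ℕ) (c' : Fin (m' + 1) → Submodule Λ Y), IsMFiltration Λ M c' →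
      ∃ h : m' = m, ∀ i : Fin (m' + 1), c' i = c (Fin.cast (by rw [h]) i)) :
    IsUniqueHomogChain M (fun k ↦ c ⟨min k m, by omega⟩) m := by
  have hC : ∀ k (hk : k ≤ m), c ⟨min k m, by omega⟩ = c ⟨k, by omega⟩ := fun k hk ↦
    congrArg c (Fin.ext (min_eq_left hk))
  refine ⟨?_, ?_, fun k hk ↦ ?_, fun k hk1 hk ↦ ?_, fun k hk1 hk W hW hW' ↦ ?_,
    fun C' h0 hm hs k hk ↦ ?_⟩
  · exact (hC 0 (Nat.zero_le m)).trans hc.bot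
  · exact (hC m le_rfl).trans hc.top
  · simp only [hC k hk.le, hC (k + 1) hk]
    exact hc.isStep ⟨k, hk⟩
  · simp only [hC k hk]
    exact hc.indec _ (by simp [Fin.ext_iff]; omega)
  · simp only [hC k hk.le, hC (k + 1) hk] at hW hW' ⊢
    exact (hc.irr ⟨k, hk⟩ (by simp; omega)).exists_retraction hW hW'
  · have hf : IsMFiltration Λ M (fun i : Fin (m + 1) ↦ C' i) :=
      ⟨h0, hm, fun i ↦ (hs i i.2).lt, fun i ↦ (hs i i.2).2⟩
    obtain ⟨_, h⟩ := huniq m _ hf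
    exact (h ⟨k, by omega⟩).trans (hC k hk).symm

end Filtration

/-- Let `M` be an indecomposable brick and `Y` a module with a
homogeneous `M`-filtration `M = M[1] ⊂ ⋯ ⊂ M[m] = Y` which is the only `M`-filtration
of `Y`. If `U` is a piling submodule of `Y` with `|U| ≥ |M|`, then `U = M[j]` for some
`1 ≤ j ≤ m`. -/
theorem gabriel_roiter_stmt16
    (k : Type u) [CommRing k] [IsArtinianRing k]
    (Λ : Type u) [Ring Λ] [Algebra k Λ] [Module.Finite k Λ]
    (M : Type v) [AddCommGroup M] [Module Λ M] (hMfl : IsFiniteLength Λ M)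
    (hMind : IndecMod Λ M) (hMbrick : IsBrick Λ M)
    (Y : Type v) [AddCommGroup Y] [Module Λ Y] (hYfl : IsFiniteLength Λ Y)
    (m : ℕ) (c : Fin (m + 1) → Submodule Λ Y) (hc : IsHomogMFiltration Λ M c)
    (huniq : ∀ (m' : ℕ) (c' : Fin (m' + 1) → Submodule Λ Y), IsMFiltration Λ M c' →
      ∃ h : m' = m, ∀ i : Fin (m' + 1), c' i = c (Fin.cast (by rw [h]) i))
    (U : Submodule Λ Y) (hU : IsPilingSub Λ U)
    (hlen : modLen Λ M ≤ Order.height U) :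
    ∃ j : Fin (m + 1), j ≠ 0 ∧ U = c j := by
  obtain ⟨_, _⟩ := isFiniteLength_iff_isNoetherian_isArtinian.1 hMfl
  obtain ⟨_, _⟩ := isFiniteLength_iff_isNoetherian_isArtinian.1 hYfl
  have : Nontrivial M := ⟨hMbrick.1.choose, 0, hMbrick.1.choose_spec⟩
  have H := isUniqueHomogChain_of_isHomogMFiltration hc huniq
  have hm : 1 ≤ m := by
    by_contra! h
    obtain rfl : m = 0 := by omega
    refine hU.1.ne_bot (eq_bot_iff.2 (le_top.trans ?_))
    rw [← hc.top, ← hc.bot]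
    rfl
  have hlen' : subLen Λ (⊤ : Submodule Λ M) ≤ subLen Λ U := by
    rw [modLen, ← Module.length_submodule, ← Module.length_submodule, ← coe_subLen,
      ← coe_subLen] at hlen
    exact_mod_cast hlen
  obtain ⟨j, hj1, hjm, hj⟩ := H.exists_eq_of_isPilingIn hMbrick hm le_rfl
    (by rw [H.top]; exact le_top) (hU.isPilingIn _) hlen'
  refine ⟨_, ?_, hj⟩
  rw [Ne, Fin.ext_iff]
  simp
  omega
end

section
/- Let Λ be an artin algebra and M a finite length Λ-module which is a brick. Suppose Y has an M-filtration M = M[1] ⊂ M[2] ⊂ ⋯ ⊂ M[m] = Y such that all the factor modules M[i]/M[i−2] for 2 ≤ i ≤ m are indecomposable (where M[0] = 0). Then this is the only M-filtration of Y; in particular, Y, regarded as an object of the category of iterated self-extensions of M, is serial, all factors M[t]/M[s] with 0 ≤ s < t ≤ m are indecomposable, and M = M[1] is the only submodule of Y isomorphic to M. -/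
/-!
Setting: `k` is a commutative artinian ring and `Λ` an artin `k`-algebra
(an algebra over `k` which is finitely generated as a `k`-module).
All modules considered are `Λ`-modules of finite length (`IsFiniteLength Λ M`),
and `|M|` denotes the length of `M`, implemented as the height
`Order.height (⊤ : Submodule Λ M)` of the lattice of submodules
(for a submodule `N` of an ambient module, its length is `Order.height N`).
-/

universe u v

open Submodule

section Towers

variable {Λ : Type u} [Ring Λ] {M : Type v} [AddCommGroup M] [Module Λ M]
  {Y : Type v} [AddCommGroup Y] [Module Λ Y]

/-- Indecomposability of the interval `[P, N]` in the lattice of submodules. -/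
def IndecInterval (P N : Submodule Λ Y) : Prop :=
  P < N ∧ ∀ A B : Submodule Λ Y, A ⊔ B = N → A ⊓ B = P → A = P ∨ B = P

theorem indecMod_quotient_iff {P N : Submodule Λ Y} (hPN : P ≤ N) :
    IndecMod Λ (↥N ⧸ comap N.subtype P) ↔ IndecInterval P N := by
  have hbot : ∀ A : Submodule Λ Y, P ≤ A → A ≤ N →
      ((A.comap N.subtype).map (comap N.subtype P).mkQ = ⊥ ↔ A = P) := by
    intro A hPA hAN
    rw [eq_bot_iff, map_le_iff_le_comap, comap_bot, ker_mkQ]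
    constructor
    · intro h
      exact le_antisymm (fun x hx => h (show (⟨x, hAN hx⟩ : N) ∈ A.comap N.subtype from hx)) hPA
    · rintro rfl
      exact le_rfl
  constructor
  · rintro ⟨hne, hdec⟩
    refine ⟨lt_of_le_of_ne hPN ?_, fun A B hsup hinf => ?_⟩
    · rintro rfl
      apply hne
      rw [eq_bot_iff]
      intro z _
      obtain ⟨x, rfl⟩ := mkQ_surjective _ z
      exact (Submodule.Quotient.mk_eq_zero _).2 x.2
    · have hA : A ≤ N := hsup ▸ le_sup_left
      have hB : B ≤ N := hsup ▸ le_sup_right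
      have hPA : P ≤ A := hinf ▸ inf_le_left
      have hPB : P ≤ B := hinf ▸ inf_le_right
      refine (hdec _ _ le_top le_top ?_ ?_).imp (hbot A hPA hA).1 (hbot B hPB hB).1
      · rw [← Submodule.map_sup, eq_top_iff, ← range_mkQ (comap N.subtype P),
          ← Submodule.map_top]
        refine Submodule.map_mono fun x _ => ?_
        obtain ⟨a, ha, b, hb, hab⟩ := mem_sup.1 (hsup ▸ x.2 : (x : Y) ∈ A ⊔ B)
        exact mem_sup.2 ⟨⟨a, hA ha⟩, ha, ⟨b, hB hb⟩, hb, Subtype.ext hab⟩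
      · rw [eq_bot_iff]
        rintro _ ⟨⟨a, ha, rfl⟩, b, hb, hab⟩
        rw [mem_bot]
        have h : (b : Y) - a ∈ P := (Submodule.Quotient.eq (comap N.subtype P)).1 hab
        have haB : (a : Y) ∈ B := by
          simpa using B.sub_mem (show (b : Y) ∈ B from hb) (hPB h)
        exact (Submodule.Quotient.mk_eq_zero _).2
          (show (a : Y) ∈ P from hinf ▸ ⟨show (a : Y) ∈ A from ha, haB⟩)
  · rintro ⟨hlt, hdec⟩
    have hzero : ∀ S : Submodule Λ (↥N ⧸ comap N.subtype P),
        (S.comap (comap N.subtype P).mkQ).map N.subtype = P → S = ⊥ := by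
      intro S hS
      rw [eq_bot_iff]
      intro z hz
      obtain ⟨x, rfl⟩ := mkQ_surjective _ z
      exact (Submodule.Quotient.mk_eq_zero _).2 (hS ▸ mem_map_of_mem hz : N.subtype x ∈ P)
    have hP : (comap N.subtype P).map N.subtype = P := by
      rw [map_comap_subtype, inf_eq_right.2 hPN]
    refine ⟨fun h => hlt.not_ge fun x hx => ?_, fun S T _ _ hsup hinf => ?_⟩
    · have : (comap N.subtype P).mkQ ⟨x, hx⟩ ∈
          (⊤ : Submodule Λ (↥N ⧸ comap N.subtype P)) := mem_top
      rw [h, mem_bot] at this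
      exact (Submodule.Quotient.mk_eq_zero (comap N.subtype P)).1 this
    · refine (hdec _ _ ?_ ?_).imp (hzero S) (hzero T)
      · rw [← Submodule.map_sup]
        suffices h : comap (comap N.subtype P).mkQ S ⊔ comap (comap N.subtype P).mkQ T = ⊤ by
          rw [h, map_subtype_top]
        rw [eq_top_iff]
        intro x _
        obtain ⟨s, hs, t, ht, hst⟩ :=
          mem_sup.1 (hsup ▸ mem_top : (comap N.subtype P).mkQ x ∈ S ⊔ T)
        obtain ⟨y, rfl⟩ := mkQ_surjective _ s
        refine mem_sup.2 ⟨y, hs, x - y, ?_, by abel⟩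
        rw [mem_comap, map_sub, ← hst, add_sub_cancel_left]
        exact ht
      · rw [← Submodule.map_inf _ N.injective_subtype, ← comap_inf, hinf, comap_bot, ker_mkQ, hP]

/-- The factor module `N / P` is isomorphic to `M`, expressed by an embedding of `M` in
`Y / P` with image `N / P`. -/
def HasFactor (M : Type v) [AddCommGroup M] [Module Λ M] (P N : Submodule Λ Y) : Prop :=
  ∃ h : M →ₗ[Λ] Y ⧸ P, Function.Injective h ∧ comap P.mkQ (LinearMap.range h) = N

theorem hasFactor_of_quotient_equiv {P N : Submodule Λ Y} (hPN : P ≤ N)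
    (e : (↥N ⧸ comap N.subtype P) ≃ₗ[Λ] M) : HasFactor M P N := by
  refine ⟨(mapQ (comap N.subtype P) P N.subtype le_rfl).comp e.symm.toLinearMap, ?_, ?_⟩
  · rw [LinearMap.coe_comp]
    refine Function.Injective.comp (LinearMap.ker_eq_bot.1 ?_) e.symm.injective
    rw [mapQ, ker_liftQ, LinearMap.ker_comp, ker_mkQ, mkQ_map_self]
  · rw [LinearMap.range_comp, LinearEquiv.range, Submodule.map_top, mapQ, range_liftQ,
      LinearMap.range_comp, range_subtype, comap_map_mkQ, sup_eq_right.2 hPN]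

theorem HasFactor.map_subtype {N : Submodule Λ Y} {P Q : Submodule Λ N}
    (h : HasFactor M P Q) : HasFactor M (P.map N.subtype) (Q.map N.subtype) := by
  obtain ⟨f, hf, hQ⟩ := h
  have hP : P = comap N.subtype (P.map N.subtype) :=
    (comap_map_eq_of_injective N.injective_subtype P).symm
  have hPQ : P ≤ Q := by
    rw [← hQ]
    conv_lhs => rw [← ker_mkQ P]
    exact LinearMap.ker_le_comap _
  refine ⟨(mapQ P (P.map N.subtype) N.subtype hP.le).comp f, ?_, ?_⟩
  · rw [LinearMap.coe_comp]
    refine Function.Injective.comp (LinearMap.ker_eq_bot.1 ?_) hf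
    rw [mapQ, ker_liftQ, LinearMap.ker_comp, ker_mkQ, ← hP, mkQ_map_self]
  · have hr : LinearMap.range f = Q.map P.mkQ := by
      rw [← hQ, map_comap_eq_of_surjective (mkQ_surjective P)]
    rw [LinearMap.range_comp, hr, ← Submodule.map_comp, mapQ, liftQ_mkQ, Submodule.map_comp,
      comap_map_mkQ, sup_eq_right.2 (Submodule.map_mono hPQ)]

theorem exists_add_eq_of_range_le_sup {A B : Submodule Λ Y} (hAB : A ⊓ B = ⊥)
    (f : M →ₗ[Λ] Y) (hf : LinearMap.range f ≤ A ⊔ B) :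
    ∃ f₁ f₂ : M →ₗ[Λ] Y, f₁ + f₂ = f ∧ LinearMap.range f₁ ≤ A ∧ LinearMap.range f₂ ≤ B := by
  have hinj : Function.Injective (A.subtype.coprod B.subtype) := by
    rw [← LinearMap.ker_eq_bot, LinearMap.ker_coprod_of_disjoint_range]
    · simp
    · simpa [disjoint_iff] using hAB
  have hr : ∀ x, f x ∈ LinearMap.range (A.subtype.coprod B.subtype) := by
    intro x
    rw [LinearMap.range_coprod, range_subtype, range_subtype]
    exact hf ⟨x, rfl⟩
  let g := (LinearEquiv.ofInjective _ hinj).symm.toLinearMap.comp (f.codRestrict _ hr)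
  have hg : ∀ x, ((g x).1 : Y) + (g x).2 = f x := fun x =>
    congrArg Subtype.val ((LinearEquiv.ofInjective _ hinj).apply_symm_apply ⟨f x, hr x⟩)
  refine ⟨A.subtype.comp ((LinearMap.fst Λ A B).comp g),
    B.subtype.comp ((LinearMap.snd Λ A B).comp g), LinearMap.ext hg, ?_, ?_⟩
  · rintro _ ⟨x, rfl⟩
    exact (g x).1.2
  · rintro _ ⟨x, rfl⟩
    exact (g x).2.2

/-- A tower of submodules ending with the whole module, whose consecutive factors are isomorphic
to `M` and whose factors of `M`-length two are indecomposable. -/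
structure IndecTower (M : Type v) [AddCommGroup M] [Module Λ M] (m : ℕ)
    (C : ℕ → Submodule Λ Y) : Prop where
  top : C m = ⊤
  lt : ∀ i < m, C i < C (i + 1)
  factor : ∀ i < m, HasFactor M (C i) (C (i + 1))
  indec : ∀ i, i + 2 ≤ m → IndecInterval (C i) (C (i + 2))

namespace IndecTower

variable {m : ℕ} {C : ℕ → Submodule Λ Y}

theorem le (hC : IndecTower M m C) {i j : ℕ} (hij : i ≤ j) (hj : j ≤ m) : C i ≤ C j := by
  induction j, hij using Nat.le_induction with
  | base => exact le_rfl
  | succ j _ ih => exact (ih (by omega)).trans (hC.lt j (by omega)).le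

/-- Every nonzero map from the brick `M` to `Y / C s` has image `C (s + 1) / C s`. -/
theorem comap_range_eq (hC : IndecTower M m C) (hM : IsBrick Λ M) {s : ℕ} (hs : s ≤ m)
    {f : M →ₗ[Λ] Y ⧸ C s} (hf : f ≠ 0) :
    s < m ∧ comap (C s).mkQ (LinearMap.range f) = C (s + 1) := by
  classical
  set K := comap (C s).mkQ (LinearMap.range f) with hK
  have hsK : C s ≤ K := by
    conv_lhs => rw [← ker_mkQ (C s)]
    exact LinearMap.ker_le_comap _
  have hKs : ¬ K ≤ C s := by
    intro h
    apply hf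
    ext x
    obtain ⟨y, hy⟩ := mkQ_surjective (C s) (f x)
    have hyK : y ∈ K := ⟨x, hy.symm⟩
    rw [← hy]
    exact (Submodule.Quotient.mk_eq_zero _).2 (h hyK)
  have hex : ∃ i, K ≤ C i := ⟨m, hC.top ▸ le_top⟩
  obtain ⟨i, hi, hmin⟩ : ∃ i, K ≤ C i ∧ ∀ j < i, ¬ K ≤ C j :=
    ⟨Nat.find hex, Nat.find_spec hex, fun _ => Nat.find_min hex⟩
  have him : i ≤ m := by
    by_contra h
    exact hmin m (by omega) (hC.top ▸ le_top)
  have hsi : s < i := by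
    by_contra h
    exact hKs (hi.trans (hC.le (by omega) hs))
  obtain ⟨j, rfl⟩ : ∃ j, i = j + 1 := ⟨i - 1, by omega⟩
  have hKj : ¬ K ≤ C j := hmin j (by omega)
  have hsj : C s ≤ C j := hC.le (by omega) (by omega)
  obtain ⟨h, hinj, hrange⟩ := hC.factor j (by omega)
  let φ : M →ₗ[Λ] Y ⧸ C j := (Submodule.factor hsj).comp f
  have hφ : ∀ (y : Y) (x : M), (C s).mkQ y = f x → φ x = (C j).mkQ y := by
    intro y x hyx
    change Submodule.factor hsj (f x) = _
    rw [← hyx]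
    rfl
  have hφh : ∀ x, φ x ∈ LinearMap.range h := by
    intro x
    obtain ⟨y, hy⟩ := mkQ_surjective (C s) (f x)
    rw [hφ y x hy]
    have : y ∈ C (j + 1) := hi ⟨x, hy.symm⟩
    rwa [← hrange] at this
  let g : M →ₗ[Λ] M :=
    (LinearEquiv.ofInjective h hinj).symm.toLinearMap.comp (φ.codRestrict _ hφh)
  have hg : ∀ x, h (g x) = φ x := fun x =>
    congrArg Subtype.val ((LinearEquiv.ofInjective h hinj).apply_symm_apply ⟨φ x, hφh x⟩)
  have hg0 : g ≠ 0 := by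
    intro h0
    apply hKj
    rintro y ⟨x, hx⟩
    refine (Submodule.Quotient.mk_eq_zero _).1 (?_ : (C j).mkQ y = 0)
    rw [← hφ y x hx.symm, ← hg, h0, LinearMap.zero_apply, map_zero]
  obtain ⟨ginj, gsurj⟩ := hM.2 g hg0
  have hinf : K ⊓ C j = C s := by
    refine le_antisymm ?_ (le_inf hsK hsj)
    rintro y ⟨⟨x, hx⟩, hy⟩
    have hx0 : h (g x) = 0 := by
      rw [hg, hφ y x hx.symm]
      exact (Submodule.Quotient.mk_eq_zero _).2 hy
    have : x = 0 := ginj (hinj (by rw [hx0, map_zero, map_zero]))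
    refine (Submodule.Quotient.mk_eq_zero _).1 (?_ : (C s).mkQ y = 0)
    rw [← hx, this, map_zero]
  have hsup : C j ⊔ K = C (j + 1) := by
    refine le_antisymm (sup_le (hC.lt j (by omega)).le hi) fun y hy => ?_
    rw [← hrange] at hy
    obtain ⟨z, hz⟩ := hy
    obtain ⟨x, rfl⟩ := gsurj z
    obtain ⟨w, hw⟩ := mkQ_surjective (C s) (f x)
    have hwK : w ∈ K := ⟨x, hw.symm⟩
    rw [hg, hφ w x hw] at hz
    have : w - y ∈ C j := (Submodule.Quotient.eq _).1 hz
    exact mem_sup.2 ⟨-(w - y), neg_mem this, w, hwK, by abel⟩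
  rcases (show s ≤ j by omega).eq_or_lt with rfl | hlt
  · exact ⟨by omega, by rw [← hsup, sup_eq_right.2 hsK]⟩
  · obtain ⟨r, rfl⟩ : ∃ r, j = r + 1 := ⟨j - 1, by omega⟩
    exfalso
    have hr := hC.lt r (by omega)
    have hsr : C s ≤ C r := hC.le (by omega) (by omega)
    have hsup' : C (r + 1) ⊔ (C r ⊔ K) = C (r + 2) := by
      rw [← sup_assoc, sup_eq_left.2 hr.le, hsup]
    have hinf' : C (r + 1) ⊓ (C r ⊔ K) = C r := by
      rw [inf_comm, sup_inf_assoc_of_le K hr.le, hinf, sup_eq_left.2 hsr]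
    rcases (hC.indec r him).2 _ _ hsup' hinf' with h1 | h1
    · exact hr.ne' h1
    · exact hmin r (by omega) (h1 ▸ le_sup_right)

theorem eq_succ_of_hasFactor (hC : IndecTower M m C) (hM : IsBrick Λ M) {s : ℕ} (hs : s ≤ m)
    {N : Submodule Λ Y} (hN : HasFactor M (C s) N) : s < m ∧ N = C (s + 1) := by
  obtain ⟨f, hf, rfl⟩ := hN
  refine hC.comap_range_eq hM hs ?_
  rintro rfl
  obtain ⟨x, hx⟩ := hM.1
  exact hx (hf (by simp))

theorem le_and_eq_of_hasFactor (hC : IndecTower M m C) (hM : IsBrick Λ M) {n : ℕ}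
    {E : ℕ → Submodule Λ Y} (h0 : E 0 = C 0) (hE : ∀ i < n, HasFactor M (E i) (E (i + 1)))
    {i : ℕ} (hi : i ≤ n) : i ≤ m ∧ E i = C i := by
  induction i with
  | zero => exact ⟨Nat.zero_le _, h0⟩
  | succ i ih =>
    obtain ⟨him, heq⟩ := ih (by omega)
    exact hC.eq_succ_of_hasFactor hM him (heq ▸ hE i (by omega))

theorem succ_le_or_succ_le (hC : IndecTower M m C) (hM : IsBrick Λ M) {s : ℕ} (hs : s < m)
    {A B : Submodule Λ Y} (hsup : C (s + 1) ≤ A ⊔ B) (hinf : A ⊓ B = C s) :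
    C (s + 1) ≤ A ∨ C (s + 1) ≤ B := by
  have hA : C s ≤ A := hinf ▸ inf_le_left
  have hB : C s ≤ B := hinf ▸ inf_le_right
  obtain ⟨f, hf, hr⟩ := hC.factor s hs
  have hf0 : f ≠ 0 := by
    rintro rfl
    obtain ⟨x, hx⟩ := hM.1
    exact hx (hf (by simp))
  have hcomap : ∀ D, C s ≤ D → comap (C s).mkQ (D.map (C s).mkQ) = D := fun D hD => by
    rw [comap_map_mkQ, sup_eq_right.2 hD]
  have hdisj : A.map (C s).mkQ ⊓ B.map (C s).mkQ = ⊥ := by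
    apply comap_injective_of_surjective (mkQ_surjective (C s))
    rw [comap_inf, hcomap A hA, hcomap B hB, hinf, comap_bot, ker_mkQ]
  have hle : LinearMap.range f ≤ A.map (C s).mkQ ⊔ B.map (C s).mkQ := by
    rw [← Submodule.map_sup, ← map_comap_eq_of_surjective (mkQ_surjective (C s))
      (LinearMap.range f), hr]
    exact Submodule.map_mono hsup
  obtain ⟨f₁, f₂, hadd, h₁, h₂⟩ := exists_add_eq_of_range_le_sup hdisj f hle
  by_cases hz : f₁ = 0
  · right
    have hz₂ : f₂ ≠ 0 := by
      rintro rfl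
      exact hf0 (by rw [← hadd, hz, add_zero])
    rw [← (hC.comap_range_eq hM hs.le hz₂).2, ← hcomap B hB]
    exact comap_mono h₂
  · left
    rw [← (hC.comap_range_eq hM hs.le hz).2, ← hcomap A hA]
    exact comap_mono h₁

theorem indecInterval (hC : IndecTower M m C) (hM : IsBrick Λ M) {s t : ℕ} (hst : s < t)
    (ht : t ≤ m) : IndecInterval (C s) (C t) := by
  obtain ⟨d, rfl⟩ : ∃ d, t = s + d + 1 := ⟨t - s - 1, by omega⟩
  clear hst
  induction d generalizing s with
  | zero =>
    refine ⟨hC.lt s ht, fun A B hsup hinf => ?_⟩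
    rcases hC.succ_le_or_succ_le hM ht hsup.ge hinf with h | h
    · right
      rw [← hinf, right_eq_inf]
      exact le_trans (hsup ▸ le_sup_right) h
    · left
      rw [← hinf, left_eq_inf]
      exact le_trans (hsup ▸ le_sup_left) h
  | succ d ih =>
    have hs := hC.lt s (by omega)
    have hs1 := hC.lt (s + 1) (by omega)
    have key : ∀ A B : Submodule Λ Y, A ⊔ B = C (s + (d + 1) + 1) → A ⊓ B = C s →
        C (s + 1) ≤ A → B = C s := by
      intro A B hsup hinf hA
      have hind := (ih (s := s + 1) (by omega)).2 A (C (s + 1) ⊔ B)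
      rw [← sup_assoc, sup_eq_left.2 hA, hsup, inf_comm, sup_inf_assoc_of_le B hA,
        inf_comm B A, hinf, sup_eq_left.2 hs.le] at hind
      rcases hind (congrArg C (by omega)) rfl with h | h
      · subst h
        have hsup' : C (s + 1) ⊔ B ⊓ C (s + 2) = C (s + 2) := by
          rw [← sup_inf_assoc_of_le B hs1.le, hsup, inf_eq_right]
          exact hC.le (by omega) ht
        have hinf' : C (s + 1) ⊓ (B ⊓ C (s + 2)) = C s := by
          rw [← inf_assoc, hinf, inf_eq_left]
          exact hs.le.trans hs1.le
        rcases (hC.indec s (by omega)).2 _ _ hsup' hinf' with h1 | h1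
        · exact absurd h1 hs.ne'
        · rw [h1, sup_eq_left.2 hs.le] at hsup'
          exact absurd hsup' hs1.ne
      · rw [← hinf, right_eq_inf]
        exact le_trans (h ▸ le_sup_right) hA
    refine ⟨hs.trans_le (hC.le (by omega) ht), fun A B hsup hinf => ?_⟩
    rcases hC.succ_le_or_succ_le hM (s := s) (by omega)
      (hsup ▸ hC.le (by omega) ht) hinf with h | h
    · exact Or.inr (key A B hsup hinf h)
    · exact Or.inl (key B A (sup_comm A B ▸ hsup) (inf_comm A B ▸ hinf) h)

end IndecTower

/-- A finite sequence of submodules, extended to `ℕ` by its last term. -/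
def extendLast {m : ℕ} (c : Fin (m + 1) → Submodule Λ Y) (n : ℕ) : Submodule Λ Y :=
  c ⟨min n m, by omega⟩

theorem extendLast_eq {m : ℕ} (c : Fin (m + 1) → Submodule Λ Y) {n : ℕ} (hn : n < m + 1) :
    extendLast c n = c ⟨n, hn⟩ := by
  unfold extendLast
  congr 2
  omega

theorem IsMFiltration.hasFactor {m : ℕ} {c : Fin (m + 1) → Submodule Λ Y}
    (hc : IsMFiltration Λ M c) {i : ℕ} (hi : i < m) :
    HasFactor M (extendLast c i) (extendLast c (i + 1)) := by
  obtain ⟨e⟩ := hc.quot ⟨i, hi⟩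
  rw [extendLast_eq c (by omega), extendLast_eq c (by omega)]
  exact hasFactor_of_quotient_equiv (hc.lt ⟨i, hi⟩).le e

end Towers

/-- Let `M` be a brick and suppose `Y` has an `M`-filtration
`M = M[1] ⊂ M[2] ⊂ ⋯ ⊂ M[m] = Y` (recorded as `c : Fin (m+1) → Submodule Λ Y` with
`c 0 = 0`) such that all factor modules `M[i]/M[i−2]` for `2 ≤ i ≤ m` are
indecomposable. Then this is the only `M`-filtration of `Y`; in particular `Y` is
serial as an object of the category `ℱ(M)` of iterated self-extensions of `M` (any two
submodules of `Y` possessing `M`-filtrations are comparable), all factors `M[t]/M[s]`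
with `0 ≤ s < t ≤ m` are indecomposable, and `M = M[1]` is the only submodule of `Y`
isomorphic to `M`. -/
theorem gabriel_roiter_stmt18
    (k : Type u) [CommRing k] [IsArtinianRing k]
    (Λ : Type u) [Ring Λ] [Algebra k Λ] [Module.Finite k Λ]
    (M : Type v) [AddCommGroup M] [Module Λ M] (hMfl : IsFiniteLength Λ M)
    (hMbrick : IsBrick Λ M)
    (Y : Type v) [AddCommGroup Y] [Module Λ Y] (hYfl : IsFiniteLength Λ Y)
    (m : ℕ) (hm : 1 ≤ m)
    (c : Fin (m + 1) → Submodule Λ Y) (hc : IsMFiltration Λ M c)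
    (hindec2 : ∀ i : Fin (m + 1), 2 ≤ (i : ℕ) →
      IndecMod Λ (↥(c i) ⧸ Submodule.comap (c i).subtype
        (c ⟨(i : ℕ) - 2, lt_of_le_of_lt (Nat.sub_le _ _) i.isLt⟩))) :
    (∀ (m' : ℕ) (c' : Fin (m' + 1) → Submodule Λ Y), IsMFiltration Λ M c' →
      ∃ h : m' = m, ∀ i : Fin (m' + 1), c' i = c (Fin.cast (by rw [h]) i)) ∧
    (∀ N N' : Submodule Λ Y,
      (∃ (n : ℕ) (d : Fin (n + 1) → Submodule Λ ↥N), IsMFiltration Λ M d) →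
      (∃ (n : ℕ) (d : Fin (n + 1) → Submodule Λ ↥N'), IsMFiltration Λ M d) →
      N ≤ N' ∨ N' ≤ N) ∧
    (∀ s t : Fin (m + 1), s < t →
      IndecMod Λ (↥(c t) ⧸ Submodule.comap (c t).subtype (c s))) ∧
    (∀ N : Submodule Λ Y, Nonempty (↥N ≃ₗ[Λ] M) → N = c ⟨1, by omega⟩) := by
  have hlt : ∀ i < m, extendLast c i < extendLast c (i + 1) := by
    intro i hi
    rw [extendLast_eq c (by omega), extendLast_eq c (by omega)]
    exact hc.lt ⟨i, hi⟩
  have hC : IndecTower M m (extendLast c) :=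
    { top := by
        rw [extendLast_eq c (by omega)]
        exact hc.top
      lt := hlt
      factor := fun i hi => hc.hasFactor hi
      indec := by
        intro i hi
        have hle := (hlt i (by omega)).le.trans (hlt (i + 1) (by omega)).le
        have h := hindec2 ⟨i + 2, by omega⟩ (by simp)
        rw [extendLast_eq c (by omega), extendLast_eq c (by omega)] at hle ⊢
        exact (indecMod_quotient_iff hle).1 h }
  have h0 : extendLast c 0 = ⊥ := by
    rw [extendLast_eq c (by omega)]
    exact hc.bot
  refine ⟨fun m' c' hc' => ?_, fun N N' => ?_, fun s t hst => ?_, ?_⟩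
  · have h0' : extendLast c' 0 = extendLast c 0 := by
      rw [h0, extendLast_eq c' (by omega)]
      exact hc'.bot
    have key : ∀ i ≤ m', i ≤ m ∧ extendLast c' i = extendLast c i := fun i hi =>
      hC.le_and_eq_of_hasFactor hMbrick h0' (fun i hi => hc'.hasFactor hi) hi
    have hm' : m' = m := by
      obtain ⟨hle, heq⟩ := key m' le_rfl
      by_contra hne
      have htop : extendLast c' m' = ⊤ := by
        rw [extendLast_eq c' (by omega)]
        exact hc'.top
      exact not_top_lt (htop ▸ heq ▸ hlt m' (by omega))
    refine ⟨hm', fun i => ?_⟩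
    have h := (key i (by omega)).2
    rwa [extendLast_eq c' i.isLt, extendLast_eq c (by omega)] at h
  · have key : ∀ N : Submodule Λ Y,
        (∃ (n : ℕ) (d : Fin (n + 1) → Submodule Λ ↥N), IsMFiltration Λ M d) →
        ∃ n ≤ m, N = extendLast c n := by
      rintro N ⟨n, d, hd⟩
      obtain ⟨hn, heq⟩ := hC.le_and_eq_of_hasFactor hMbrick (n := n)
        (E := fun i => (extendLast d i).map N.subtype)
        (by
          rw [h0, extendLast_eq d (by omega)]
          exact (congrArg (Submodule.map N.subtype) hd.bot).trans (Submodule.map_bot _))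
        (fun i hi => (hd.hasFactor hi).map_subtype) le_rfl
      refine ⟨n, hn, ?_⟩
      rw [← heq, extendLast_eq d (by omega)]
      exact (map_subtype_top N).symm.trans (congrArg (Submodule.map N.subtype) hd.top.symm)
    intro hN hN'
    obtain ⟨n, hn, rfl⟩ := key N hN
    obtain ⟨n', hn', rfl⟩ := key N' hN'
    exact (le_total n n').imp (fun h => hC.le h hn') (fun h => hC.le h hn)
  · have h := hC.indecInterval hMbrick (show (s : ℕ) < t from hst) (by omega)
    rw [extendLast_eq c s.isLt, extendLast_eq c t.isLt] at h
    exact (indecMod_quotient_iff h.1.le).2 h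
  · rintro N ⟨e⟩
    have hN : HasFactor M (extendLast c 0) N := by
      rw [h0]
      refine ⟨(mkQ ⊥).comp (N.subtype.comp e.symm.toLinearMap), ?_, ?_⟩
      · rw [LinearMap.coe_comp]
        refine Function.Injective.comp (LinearMap.ker_eq_bot.1 (ker_mkQ _)) ?_
        exact N.injective_subtype.comp e.symm.injective
      · rw [LinearMap.range_comp, LinearMap.range_comp, LinearEquiv.range, Submodule.map_top,
          range_subtype, comap_map_mkQ, bot_sup_eq]
    rw [(hC.eq_succ_of_hasFactor hMbrick (Nat.zero_le m) hN).2, extendLast_eq c (by omega)]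
end
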